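/- arXiv:1310.7984 — 3 statements merged into one kernel-verified Lean document; each statement's English description precedes it below -/
import Mathlib

section
/- Let G be a finite simple connected bipartite graph on n vertices and I(G*) the edge ideal of its whisker graph in S* = K[x_1,...,x_n,y_1,...,y_n]. Then depth(S*/I(G*)^k) = 1 for all k ≥ n. -/
open MvPolynomial

/-- The depth of the module `M` with respect to the ideal `m`: the supremum of the
lengths of `M`-regular sequences consisting of elements of `m`. -/
noncomputable def idealDepth {R : Type*} [CommRing R] (m : Ideal R)
    (M : Type*) [AddCommGroup M] [Module R M] : ℕ :=
  sSup {d : ℕ | ∃ rs : List R, rs.length = d ∧ (∀ r ∈ rs, r ∈ m) ∧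
    RingTheory.Sequence.IsRegular M rs}

/-- The graded maximal ideal of a polynomial ring, generated by all the variables. -/
noncomputable def maxIdeal (σ K : Type*) [Field K] : Ideal (MvPolynomial σ K) :=
  Ideal.span (Set.range X)

/-- The edge ideal of the whisker graph `G*` of a graph `G` on `{1,…,n}`, inside
`S* = K[x_1,…,x_n,y_1,…,y_n]`, where `x_i = X (Sum.inl i)` and `y_i = X (Sum.inr i)`.
It is generated by `x_i x_j` for edges `{i,j}` of `G` and by `x_i y_i` for all `i`. -/
noncomputable def whiskerEdgeIdeal {n : ℕ} (K : Type*) [Field K] (G : SimpleGraph (Fin n)) :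
    Ideal (MvPolynomial (Fin n ⊕ Fin n) K) :=
  Ideal.span ({p | ∃ i j, G.Adj i j ∧ p = X (Sum.inl i) * X (Sum.inl j)} ∪
    Set.range (fun i : Fin n => X (Sum.inl i) * X (Sum.inr i)))



section BalancedSplit

variable {A B : Type*} [DecidableEq A] [DecidableEq B]

/-- Two multisets of edges of a bipartite multigraph are balanced if the degrees of every vertex
in them differ by at most one. -/
def BalancedEdges (E₁ E₂ : Multiset (A × B)) : Prop :=
  (∀ a, (E₁.map Prod.fst).count a ≤ (E₂.map Prod.fst).count a + 1 ∧
    (E₂.map Prod.fst).count a ≤ (E₁.map Prod.fst).count a + 1) ∧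
  ∀ b, (E₁.map Prod.snd).count b ≤ (E₂.map Prod.snd).count b + 1 ∧
    (E₂.map Prod.snd).count b ≤ (E₁.map Prod.snd).count b + 1

theorem BalancedEdges.symm {E₁ E₂ : Multiset (A × B)} (h : BalancedEdges E₁ E₂) :
    BalancedEdges E₂ E₁ :=
  ⟨fun a => (h.1 a).symm, fun b => (h.2 b).symm⟩

theorem Multiset.exists_eq_cons_of_count_map_pos {α β : Type*} [DecidableEq β] {f : α → β}
    {b : β} {E : Multiset α} (h : 0 < (E.map f).count b) : ∃ e F, E = e ::ₘ F ∧ f e = b := by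
  obtain ⟨e, he, rfl⟩ := Multiset.mem_map.1 (Multiset.count_pos.1 h)
  obtain ⟨F, rfl⟩ := Multiset.exists_cons_of_mem he
  exact ⟨e, F, rfl, rfl⟩

theorem Multiset.exists_eq_cons_cons_of_one_lt_count_map {α β : Type*} [DecidableEq β]
    {f : α → β} {b : β} {E : Multiset α} (h : 1 < (E.map f).count b) :
    ∃ e e' F, E = e ::ₘ e' ::ₘ F ∧ f e = b ∧ f e' = b := by
  obtain ⟨e, F, rfl, rfl⟩ := exists_eq_cons_of_count_map_pos (zero_lt_one.trans h)
  rw [map_cons, count_cons_self, Nat.lt_add_left_iff_pos] at h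
  obtain ⟨e', F, rfl, hmap⟩ := exists_eq_cons_of_count_map_pos h
  exact ⟨e, e', F, rfl, rfl, hmap⟩

/-- The edges of a bipartite multigraph can be split into two classes such that the degrees of
every vertex in the two classes differ by at most one. -/
theorem exists_balancedEdges (E : Multiset (A × B)) :
    ∃ E₁ E₂, E₁ + E₂ = E ∧ BalancedEdges E₁ E₂ := by
  induction h : E.card using Nat.strong_induction_on generalizing E with
  | _ N ih =>
  subst h
  by_cases hwalk : ∃ a a' b b' F, E = (a, b) ::ₘ (a', b) ::ₘ (a', b') ::ₘ F
  · obtain ⟨a, a', b, b', F, rfl⟩ := hwalk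
    obtain ⟨E₁, E₂, hE, hbal⟩ := ih _ (by simp) ((a, b') ::ₘ F) rfl
    wlog hmem : (a, b') ∈ E₁ generalizing E₁ E₂
    · refine this E₂ E₁ (by rw [add_comm, hE]) hbal.symm ?_
      have : (a, b') ∈ E₁ + E₂ := hE ▸ Multiset.mem_cons_self _ _
      exact (Multiset.mem_add.1 this).resolve_left hmem
    obtain ⟨E₁, rfl⟩ := Multiset.exists_cons_of_mem hmem
    rw [Multiset.cons_add, Multiset.cons_inj_right] at hE
    subst hE
    refine ⟨(a, b) ::ₘ (a', b') ::ₘ E₁, (a', b) ::ₘ E₂, ?_, ?_, ?_⟩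
    · simp only [← Multiset.singleton_add]
      abel
    · intro c
      have := hbal.1 c
      simp only [Multiset.map_cons, Multiset.count_cons] at this ⊢
      omega
    · intro c
      have := hbal.2 c
      simp only [Multiset.map_cons, Multiset.count_cons] at this ⊢
      omega
  by_cases hsnd : ∃ a a' b F, E = (a, b) ::ₘ (a', b) ::ₘ F
  · obtain ⟨a, a', b, F, rfl⟩ := hsnd
    obtain ⟨E₁, E₂, rfl, hbal⟩ := ih _ (by simp) F rfl
    refine ⟨(a, b) ::ₘ E₁, (a', b) ::ₘ E₂, ?_, ?_, ?_⟩
    · simp only [← Multiset.singleton_add]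
      abel
    · have hfree : ∀ c d, ((a, b) ::ₘ (a', b) ::ₘ (E₁ + E₂) : Multiset (A × B)) =
          (d, b) ::ₘ (c, b) ::ₘ (E₁ + E₂) → ((E₁ + E₂).map Prod.fst).count c = 0 := by
        intro c d hcd
        by_contra hne
        obtain ⟨⟨_, b'⟩, F, hF, rfl⟩ :=
          Multiset.exists_eq_cons_of_count_map_pos (Nat.pos_of_ne_zero hne)
        exact hwalk ⟨d, _, b, b', F, by rw [hcd, hF]⟩
      have ha := hfree a a' (Multiset.cons_swap _ _ _)
      have ha' := hfree a' a rfl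
      intro c
      have := hbal.1 c
      simp only [Multiset.map_cons, Multiset.count_cons, Multiset.map_add,
        Multiset.count_add] at this ha ha' ⊢
      grind
    · intro c
      have := hbal.2 c
      simp only [Multiset.map_cons, Multiset.count_cons] at this ⊢
      omega
  by_cases hfst : ∃ a b b' F, E = (a, b) ::ₘ (a, b') ::ₘ F
  · obtain ⟨a, b, b', F, rfl⟩ := hfst
    obtain ⟨E₁, E₂, rfl, hbal⟩ := ih _ (by simp) F rfl
    refine ⟨(a, b) ::ₘ E₁, (a, b') ::ₘ E₂, ?_, ?_, ?_⟩
    · simp only [← Multiset.singleton_add]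
      abel
    · intro c
      have := hbal.1 c
      simp only [Multiset.map_cons, Multiset.count_cons] at this ⊢
      omega
    · have hfree : ∀ c d, ((a, b) ::ₘ (a, b') ::ₘ (E₁ + E₂) : Multiset (A × B)) =
          (a, c) ::ₘ (a, d) ::ₘ (E₁ + E₂) → ((E₁ + E₂).map Prod.snd).count c = 0 := by
        intro c d hcd
        by_contra hne
        obtain ⟨⟨a', c⟩, F, hF, rfl⟩ :=
          Multiset.exists_eq_cons_of_count_map_pos (Nat.pos_of_ne_zero hne)
        refine hwalk ⟨a', a, c, d, F, ?_⟩
        rw [hcd, hF, Multiset.cons_swap (a, d), Multiset.cons_swap (a, c) (a', c)]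
      have hb := hfree b b' rfl
      have hb' := hfree b' b (Multiset.cons_swap _ _ _)
      intro c
      have := hbal.2 c
      simp only [Multiset.map_cons, Multiset.count_cons, Multiset.map_add,
        Multiset.count_add] at this hb hb' ⊢
      grind
  refine ⟨E, 0, add_zero E, fun a => ⟨?_, by simp⟩, fun b => ⟨?_, by simp⟩⟩
  · by_contra! hlt
    obtain ⟨⟨_, b⟩, ⟨_, b'⟩, F, hF, rfl, rfl⟩ :=
      Multiset.exists_eq_cons_cons_of_one_lt_count_map (by simpa using hlt)
    exact hfst ⟨_, b, b', F, hF⟩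
  · by_contra! hlt
    obtain ⟨⟨a, _⟩, ⟨a', _⟩, F, hF, rfl, rfl⟩ :=
      Multiset.exists_eq_cons_cons_of_one_lt_count_map (by simpa using hlt)
    exact hsnd ⟨a, a', _, F, hF⟩

end BalancedSplit

section EdgeIdeal

variable {V : Type*}

/-- The edge ideal of a graph. -/
noncomputable def edgeIdeal (K : Type*) [Field K] (H : SimpleGraph V) :
    Ideal (MvPolynomial V K) :=
  Ideal.span {p | ∃ a b, H.Adj a b ∧ p = X a * X b}

/-- The degree vector of a multiset of (ordered) edges. -/
noncomputable def edgeDegree (E : Multiset (V × V)) : V →₀ ℕ :=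
  (E.map fun e => Finsupp.single e.1 1 + Finsupp.single e.2 1).sum

theorem edgeDegree_cons (e : V × V) (E : Multiset (V × V)) :
    edgeDegree (e ::ₘ E) = Finsupp.single e.1 1 + Finsupp.single e.2 1 + edgeDegree E := by
  simp [edgeDegree]

theorem edgeDegree_add (E F : Multiset (V × V)) :
    edgeDegree (E + F) = edgeDegree E + edgeDegree F := by
  simp [edgeDegree]

theorem edgeDegree_apply [DecidableEq V] (E : Multiset (V × V)) (v : V) :
    edgeDegree E v = (E.map Prod.fst).count v + (E.map Prod.snd).count v := by
  induction E using Multiset.induction_on with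
  | empty => simp [edgeDegree]
  | cons e E ih =>
    simp only [edgeDegree_cons, Finsupp.add_apply, ih, Multiset.map_cons, Multiset.count_cons,
      Finsupp.single_apply, eq_comm (a := v)]
    omega

/-- The edges of a bipartite graph, directed from the colour `true` to the colour `false`. -/
def IsOrientedEdge {H : SimpleGraph V} (c : H.Coloring Bool) (e : V × V) : Prop :=
  H.Adj e.1 e.2 ∧ c e.1 = true ∧ c e.2 = false

/-- The exponents dominating the degree vector of a multiset of at least `k` edges. -/
def edgePowerExponents {H : SimpleGraph V} (c : H.Coloring Bool) (k : ℕ) : Set (V →₀ ℕ) :=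
  {m | ∃ E : Multiset (V × V), (∀ e ∈ E, IsOrientedEdge c e) ∧ k ≤ E.card ∧ edgeDegree E ≤ m}

variable {K : Type*} [Field K] {H : SimpleGraph V} (c : H.Coloring Bool)

theorem X_mul_X_mem_edgeIdeal {a b : V} (h : H.Adj a b) :
    (X a * X b : MvPolynomial V K) ∈ edgeIdeal K H :=
  Ideal.subset_span ⟨a, b, h, rfl⟩

theorem monomial_edgeDegree_mem {E : Multiset (V × V)} (hE : ∀ e ∈ E, IsOrientedEdge c e) :
    monomial (edgeDegree E) (1 : K) ∈ edgeIdeal K H ^ E.card := by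
  induction E using Multiset.induction_on with
  | empty => simp
  | cons e E ih =>
    rw [edgeDegree_cons, Multiset.card_cons, pow_succ', ← mul_one (1 : K), ← monomial_mul]
    refine Ideal.mul_mem_mul ?_ (ih fun e he => hE e (Multiset.mem_cons_of_mem he))
    rw [← mul_one (1 : K), ← monomial_mul]
    exact X_mul_X_mem_edgeIdeal (hE e (Multiset.mem_cons_self _ _)).1

theorem edgeIdeal_pow_eq_span (k : ℕ) :
    edgeIdeal K H ^ k =
      Ideal.span ((fun m => monomial m (1 : K)) '' edgePowerExponents c k) := by
  apply le_antisymm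
  · induction k with
    | zero =>
      rw [pow_zero, Ideal.one_eq_top, top_le_iff, Ideal.eq_top_iff_one]
      exact Ideal.subset_span ⟨0, ⟨0, by simp, le_rfl, le_rfl⟩, rfl⟩
    | succ k ih =>
      rw [pow_succ']
      refine (Ideal.mul_mono_right ih).trans ?_
      rw [edgeIdeal, Ideal.span_mul_span', Ideal.span_le]
      rintro _ ⟨_, ⟨a, b, hab, rfl⟩, _, ⟨m, ⟨E, hE, hk, hm⟩, rfl⟩, rfl⟩
      obtain ⟨e, he, hX⟩ : ∃ e : V × V, IsOrientedEdge c e ∧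
          (X a * X b : MvPolynomial V K) = X e.1 * X e.2 := by
        have hne := c.valid hab
        cases ha : c a
        · exact ⟨(b, a), ⟨hab.symm, by simpa [ha] using hne.symm, ha⟩, mul_comm _ _⟩
        · exact ⟨(a, b), ⟨hab, ha, by simpa [ha] using hne.symm⟩, rfl⟩
      refine Ideal.subset_span ⟨Finsupp.single e.1 1 + Finsupp.single e.2 1 + m,
        ⟨e ::ₘ E, ?_, by simpa using hk, ?_⟩, ?_⟩
      · simpa [he] using hE
      · rw [edgeDegree_cons]
        gcongr
      · change _ = X a * X b * monomial m 1
        rw [hX]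
        simp only [X, monomial_mul, mul_one]
  · rw [Ideal.span_le]
    rintro _ ⟨m, ⟨E, hE, hk, hm⟩, rfl⟩
    obtain ⟨m, rfl⟩ := exists_add_of_le hm
    simp only [SetLike.mem_coe]
    rw [← mul_one (1 : K), ← monomial_mul]
    exact Ideal.mul_mem_right _ _ (Ideal.pow_le_pow_right hk (monomial_edgeDegree_mem c hE))

theorem mem_edgeIdeal_pow_iff {k : ℕ} {p : MvPolynomial V K} :
    p ∈ edgeIdeal K H ^ k ↔ ∀ m ∈ p.support, m ∈ edgePowerExponents c k := by
  rw [edgeIdeal_pow_eq_span c, mem_ideal_span_monomial_image]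
  refine forall₂_congr fun m _ => ⟨?_, fun h => ⟨m, h, le_rfl⟩⟩
  rintro ⟨m', ⟨E, hE, hk, hm'⟩, hle⟩
  exact ⟨E, hE, hk, hm'.trans hle⟩

theorem count_fst_eq_zero [DecidableEq V] {E : Multiset (V × V)}
    (hE : ∀ e ∈ E, IsOrientedEdge c e) {v : V} (hv : c v = false) :
    (E.map Prod.fst).count v = 0 := by
  rw [Multiset.count_eq_zero, Multiset.mem_map]
  rintro ⟨e, he, rfl⟩
  simp [(hE e he).2.1] at hv

theorem count_snd_eq_zero [DecidableEq V] {E : Multiset (V × V)}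
    (hE : ∀ e ∈ E, IsOrientedEdge c e) {v : V} (hv : c v = true) :
    (E.map Prod.snd).count v = 0 := by
  rw [Multiset.count_eq_zero, Multiset.mem_map]
  rintro ⟨e, he, rfl⟩
  simp [(hE e he).2.2] at hv

/-- A halving property of the powers of the edge ideal of a bipartite graph. -/
theorem mem_edgePowerExponents_of_two_nsmul {k : ℕ} {m : V →₀ ℕ}
    (h : 2 • m ∈ edgePowerExponents c (2 * k - 1)) : m ∈ edgePowerExponents c k := by
  classical
  obtain ⟨E, hE, hk, hm⟩ := h
  obtain ⟨E₁, E₂, rfl, hbal⟩ := exists_balancedEdges E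
  wlog hcard : E₂.card ≤ E₁.card generalizing E₁ E₂
  · rw [add_comm] at hE hk hm
    exact this E₂ E₁ hbal.symm hE hk hm (le_of_not_ge hcard)
  have hE₁ : ∀ e ∈ E₁, IsOrientedEdge c e := fun e he => hE e (Multiset.mem_add.2 (.inl he))
  have hE₂ : ∀ e ∈ E₂, IsOrientedEdge c e := fun e he => hE e (Multiset.mem_add.2 (.inr he))
  refine ⟨E₁, hE₁, by rw [Multiset.card_add] at hk; omega, fun v => ?_⟩
  have hv := hm v
  simp only [edgeDegree_add, Finsupp.add_apply, edgeDegree_apply, Finsupp.smul_apply,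
    smul_eq_mul] at hv ⊢
  have h₁ := hbal.1 v
  have h₂ := hbal.2 v
  cases hcv : c v
  · have := count_fst_eq_zero c hE₁ hcv
    have := count_fst_eq_zero c hE₂ hcv
    omega
  · have := count_snd_eq_zero c hE₁ hcv
    have := count_snd_eq_zero c hE₂ hcv
    omega

theorem exists_eq_cons_of_edgeDegree_ne_zero {E : Multiset (V × V)} {v : V}
    (h : edgeDegree E v ≠ 0) : ∃ e F, E = e ::ₘ F ∧ (e.1 = v ∨ e.2 = v) := by
  classical
  rw [edgeDegree_apply] at h
  rcases Nat.eq_zero_or_pos ((E.map Prod.fst).count v) with h0 | hpos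
  · obtain ⟨e, F, hF, he⟩ :=
      Multiset.exists_eq_cons_of_count_map_pos (E := E) (f := Prod.snd) (b := v) (by omega)
    exact ⟨e, F, hF, .inr he⟩
  · obtain ⟨e, F, hF, he⟩ := Multiset.exists_eq_cons_of_count_map_pos hpos
    exact ⟨e, F, hF, .inl he⟩

/-- If `y` is a leaf with neighbour `x`, then membership in a power of the edge ideal can be
tested after multiplication by `x` and by `y`. -/
theorem mem_edgePowerExponents_of_leaf {x y : V} (hxy : H.Adj x y)
    (hleaf : ∀ z, H.Adj z y → z = x) {k : ℕ} {m : V →₀ ℕ}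
    (hx : Finsupp.single x 1 + m ∈ edgePowerExponents c k)
    (hy : Finsupp.single y 1 + m ∈ edgePowerExponents c k) : m ∈ edgePowerExponents c k := by
  classical
  obtain ⟨E₁, hE₁, hk₁, hm₁⟩ := hx
  obtain ⟨E₂, hE₂, hk₂, hm₂⟩ := hy
  apply mem_edgePowerExponents_of_two_nsmul
  obtain ⟨E, hEdef⟩ : ∃ E, E = E₁ + E₂ := ⟨_, rfl⟩
  have hE : ∀ e ∈ E, IsOrientedEdge c e := fun e he =>
    (Multiset.mem_add.1 (hEdef ▸ he)).elim (hE₁ e) (hE₂ e)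
  have hcard : 2 * k ≤ E.card := by
    rw [hEdef, Multiset.card_add]
    omega
  have hdeg : ∀ v, edgeDegree E v ≤
      2 * m v + (if x = v then 1 else 0) + (if y = v then 1 else 0) := by
    intro v
    have h₁ := hm₁ v
    have h₂ := hm₂ v
    simp only [Finsupp.add_apply, Finsupp.single_apply] at h₁ h₂
    rw [hEdef, edgeDegree_add, Finsupp.add_apply]
    omega
  clear hEdef
  have hne := hxy.ne
  by_cases hy0 : edgeDegree E y = 0
  · by_cases hx0 : edgeDegree E x = 0
    · refine ⟨E, hE, by omega, fun v => ?_⟩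
      have := hdeg v
      simp only [Finsupp.smul_apply, smul_eq_mul]
      grind
    · obtain ⟨e, F, rfl, he⟩ := exists_eq_cons_of_edgeDegree_ne_zero hx0
      refine ⟨F, fun e he => hE e (Multiset.mem_cons_of_mem he), ?_, fun v => ?_⟩
      · rw [Multiset.card_cons] at hcard
        omega
      have := hdeg v
      simp only [edgeDegree_cons, Finsupp.add_apply, Finsupp.single_apply, Finsupp.smul_apply,
        smul_eq_mul] at this hy0 ⊢
      grind
  · obtain ⟨e, F, rfl, he⟩ := exists_eq_cons_of_edgeDegree_ne_zero hy0
    have hadj := (hE e (Multiset.mem_cons_self _ _)).1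
    have he' : (e.1 = x ∧ e.2 = y) ∨ (e.1 = y ∧ e.2 = x) := by
      rcases he with h | h
      · exact .inr ⟨h, hleaf _ (h ▸ hadj.symm)⟩
      · exact .inl ⟨hleaf _ (h ▸ hadj), h⟩
    refine ⟨F, fun e he => hE e (Multiset.mem_cons_of_mem he), ?_, fun v => ?_⟩
    · rw [Multiset.card_cons] at hcard
      omega
    have := hdeg v
    simp only [edgeDegree_cons, Finsupp.add_apply, Finsupp.single_apply, Finsupp.smul_apply,
      smul_eq_mul] at this ⊢
    rcases he' with ⟨h₁, h₂⟩ | ⟨h₁, h₂⟩ <;> rw [h₁, h₂] at this <;> omega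

theorem mem_edgeIdeal_pow_of_leaf (c : H.Coloring Bool) {x y : V} (hxy : H.Adj x y)
    (hleaf : ∀ z, H.Adj z y → z = x) {k : ℕ} {p : MvPolynomial V K}
    (hx : X x * p ∈ edgeIdeal K H ^ k) (hy : X y * p ∈ edgeIdeal K H ^ k) :
    p ∈ edgeIdeal K H ^ k := by
  rw [mem_edgeIdeal_pow_iff c] at hx hy ⊢
  intro m hm
  rw [mem_support_iff] at hm
  refine mem_edgePowerExponents_of_leaf c hxy hleaf (hx _ ?_) (hy _ ?_) <;>
  rwa [mem_support_iff, coeff_X_mul]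

/-- Every monomial in the `k`-th power of the edge ideal has degree at least `k` in the variables
of each colour. -/
theorem le_sum_of_mem_edgePowerExponents [Fintype V] {k : ℕ} {m : V →₀ ℕ}
    (h : m ∈ edgePowerExponents c k) (i : Bool) : k ≤ ∑ v with c v = i, m v := by
  classical
  obtain ⟨E, hE, hk, hm⟩ := h
  refine hk.trans (le_trans ?_ (Finset.sum_le_sum fun v _ => hm v))
  clear hk hm
  induction E using Multiset.induction_on with
  | empty => simp
  | cons e E ih =>
    have ih := ih fun e he => hE e (Multiset.mem_cons_of_mem he)
    obtain ⟨-, h₁, h₂⟩ := hE e (Multiset.mem_cons_self _ _)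
    rw [edgeDegree_cons, Multiset.card_cons]
    simp only [Finsupp.add_apply, Finset.sum_add_distrib, Finsupp.single_apply,
      Finset.sum_ite_eq, Finset.mem_filter, Finset.mem_univ, true_and, h₁, h₂]
    cases i <;> simp at ih ⊢ <;> omega

end EdgeIdeal

section RegularSequence

open scoped Pointwise

variable {R M : Type*} [CommRing R] [AddCommGroup M] [Module R M]

theorem exists_isSMulRegular_of_forall_smul_eq_zero [IsNoetherianRing R] [Module.Finite R M]
    (m : Ideal R) (h : ∀ g : M, (∀ r ∈ m, r • g = 0) → g = 0) :
    ∃ f ∈ m, IsSMulRegular M f := by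
  by_contra! hreg
  obtain ⟨P, hP, hmP⟩ := (m.subset_union_prime_finite (associatedPrimes.finite R M) (f := id) 0 0
    fun _ hP _ _ => hP.isPrime).1 <| by
      simp_rw [id, biUnion_associatedPrimes_eq_compl_regular]
      exact hreg
  obtain ⟨hprime, g, hg⟩ := Submodule.isAssociatedPrime_iff.1 hP
  have hann : ∀ r, r ∈ P ↔ r • g = 0 := fun r => by
    rw [hg, Submodule.mem_colon_singleton, Submodule.mem_bot]
  have hg0 : g = 0 := h g fun r hr => (hann r).1 (hmP hr)
  exact hprime.ne_top ((Ideal.eq_top_iff_one P).2 ((hann 1).2 (by rw [hg0, smul_zero])))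

/-- If the ideal generated by a finite family `x` contains a regular sequence of length two on `M`,
then every family `g` with `x v • g w = x w • g v` comes from a single element of `M`. -/
theorem exists_eq_smul_of_isWeaklyRegular {ι : Type*} [Fintype ι] {x : ι → R} {f₁ f₂ : R}
    {rs : List R} (h₁ : f₁ ∈ Ideal.span (Set.range x)) (h₂ : f₂ ∈ Ideal.span (Set.range x))
    (h : RingTheory.Sequence.IsWeaklyRegular M (f₁ :: f₂ :: rs)) {g : ι → M}
    (hg : ∀ v w, x v • g w = x w • g v) : ∃ q, ∀ v, g v = x v • q := by
  rw [RingTheory.Sequence.isWeaklyRegular_cons_iff,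
    RingTheory.Sequence.isWeaklyRegular_cons_iff] at h
  obtain ⟨hf₁, hf₂, -⟩ := h
  obtain ⟨c, rfl⟩ := Ideal.mem_span_range_iff_exists_fun.1 h₁
  obtain ⟨d, rfl⟩ := Ideal.mem_span_range_iff_exists_fun.1 h₂
  have key : ∀ w, x w • ∑ v, c v • g v = (∑ v, c v * x v) • g w := fun w => by
    rw [Finset.smul_sum, Finset.sum_smul]
    exact Finset.sum_congr rfl fun v _ => by rw [smul_comm, hg w v, mul_smul]
  have hmem : ∑ v, c v • g v ∈ (∑ v, c v * x v) • (⊤ : Submodule R M) := by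
    rw [← Submodule.Quotient.mk_eq_zero]
    refine hf₂.right_eq_zero_of_smul ?_
    rw [← Submodule.Quotient.mk_smul, Submodule.Quotient.mk_eq_zero,
      Submodule.mem_smul_pointwise_iff_exists]
    refine ⟨∑ w, d w • g w, trivial, ?_⟩
    rw [Finset.smul_sum, Finset.sum_smul]
    exact Finset.sum_congr rfl fun w _ => by rw [smul_comm, ← key, mul_smul]
  obtain ⟨q, -, hq⟩ := (Submodule.mem_smul_pointwise_iff_exists _ _ _).1 hmem
  refine ⟨q, fun w => hf₁ ?_⟩
  change (∑ v, c v * x v) • g w = (∑ v, c v * x v) • x w • q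
  rw [← key, ← hq, smul_comm]

end RegularSequence

section EdgeIdealDepth

variable {V : Type*} {K : Type*} [Field K] {H : SimpleGraph V}

theorem edgeIdeal_le_maxIdeal : edgeIdeal K H ≤ maxIdeal V K := by
  rw [edgeIdeal, Ideal.span_le]
  rintro _ ⟨a, b, -, rfl⟩
  exact Ideal.mul_mem_right _ _ (Ideal.subset_span ⟨a, rfl⟩)

theorem one_notMem_maxIdeal : (1 : MvPolynomial V K) ∉ maxIdeal V K := by
  intro h
  have hle : maxIdeal V K ≤ RingHom.ker (constantCoeff (σ := V) (R := K)) := by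
    rw [maxIdeal, Ideal.span_le]
    rintro _ ⟨v, rfl⟩
    simp
  simpa using hle h

variable [Fintype V]

theorem coeff_eq_zero_of_X_mul_mem (c : H.Coloring Bool) {k : ℕ} {u : V →₀ ℕ}
    (hu : ∀ i, ∑ v with c v = i, u v < k) {a : V} {p : MvPolynomial V K}
    (hp : X a * p ∈ edgeIdeal K H ^ k) : p.coeff u = 0 := by
  classical
  by_contra hne
  have hmem := (mem_edgeIdeal_pow_iff c).1 hp (Finsupp.single a 1 + u)
    (by rwa [mem_support_iff, coeff_X_mul])
  have hle := le_sum_of_mem_edgePowerExponents c hmem (!c a)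
  have hlt := hu (!c a)
  simp only [Finsupp.add_apply, Finset.sum_add_distrib, Finsupp.single_apply,
    Finset.sum_ite_eq, Finset.mem_filter] at hle
  simp at hle
  omega

/-- A monomial `u` of degree less than `k` in the variables of either colour such that
`X a * X b * u` lies in the `k`-th power of the edge ideal for all `a`, `b` of different colours
prevents the existence of a regular sequence of length two. -/
theorem not_isWeaklyRegular_of_monomial (c : H.Coloring Bool) {k : ℕ} {u : V →₀ ℕ}
    (hu : ∀ i, ∑ v with c v = i, u v < k)
    (hmem : ∀ a b, c a = true → c b = false →
      X a * X b * monomial u (1 : K) ∈ edgeIdeal K H ^ k)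
    {a b : V} (ha : c a = true) (hb : c b = false) {f₁ f₂ : MvPolynomial V K}
    {rs : List (MvPolynomial V K)} (h₁ : f₁ ∈ maxIdeal V K) (h₂ : f₂ ∈ maxIdeal V K) :
    ¬ RingTheory.Sequence.IsWeaklyRegular (MvPolynomial V K ⧸ edgeIdeal K H ^ k)
      (f₁ :: f₂ :: rs) := by
  intro hreg
  have hsmul (p q : MvPolynomial V K) : p • Ideal.Quotient.mk (edgeIdeal K H ^ k) q =
      Ideal.Quotient.mk (edgeIdeal K H ^ k) (p * q) := rfl
  obtain ⟨q, hq⟩ := exists_eq_smul_of_isWeaklyRegular h₁ h₂ hreg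
    (g := fun v => if c v = true then Ideal.Quotient.mk _ (X v * monomial u (1 : K)) else 0)
    (by
      intro v w
      cases hv : c v <;> cases hw : c w <;>
        simp only [Bool.false_eq_true, if_true, if_false, smul_zero, hsmul]
      · rw [Ideal.Quotient.eq_zero_iff_mem, ← mul_assoc, mul_comm (X v)]
        exact hmem w v hw hv
      · rw [eq_comm, Ideal.Quotient.eq_zero_iff_mem, ← mul_assoc, mul_comm (X w)]
        exact hmem v w hv hw
      · rw [mul_left_comm])
  obtain ⟨q, rfl⟩ := Ideal.Quotient.mk_surjective q
  have hqa := hq a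
  have hqb := hq b
  simp only [ha, hb, if_true, Bool.false_eq_true, if_false, hsmul] at hqa hqb
  rw [Ideal.Quotient.eq, ← mul_sub] at hqa
  rw [eq_comm, Ideal.Quotient.eq_zero_iff_mem] at hqb
  have hca := coeff_eq_zero_of_X_mul_mem c hu hqa
  have hcb := coeff_eq_zero_of_X_mul_mem c hu hqb
  classical simp [hcb, coeff_monomial] at hca

/-- The powers of the edge ideal of a bipartite graph with a leaf have positive depth. -/
theorem exists_isRegular_singleton_of_leaf (c : H.Coloring Bool) {x y : V} (hxy : H.Adj x y)
    (hleaf : ∀ z, H.Adj z y → z = x) {k : ℕ} (hk : k ≠ 0) :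
    ∃ f ∈ maxIdeal V K,
      RingTheory.Sequence.IsRegular (MvPolynomial V K ⧸ edgeIdeal K H ^ k) [f] := by
  obtain ⟨f, hf, hreg⟩ := exists_isSMulRegular_of_forall_smul_eq_zero
    (M := MvPolynomial V K ⧸ edgeIdeal K H ^ k) (maxIdeal V K) (by
      intro g hg
      obtain ⟨p, rfl⟩ := Ideal.Quotient.mk_surjective g
      have hX : ∀ v, X v * p ∈ edgeIdeal K H ^ k := fun v =>
        Ideal.Quotient.eq_zero_iff_mem.1 (hg (X v) (Ideal.subset_span ⟨v, rfl⟩))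
      exact Ideal.Quotient.eq_zero_iff_mem.2 (mem_edgeIdeal_pow_of_leaf c hxy hleaf (hX x) (hX y)))
  refine ⟨f, hf, ?_, fun htop => one_notMem_maxIdeal (V := V) (K := K) ?_⟩
  · rw [RingTheory.Sequence.isWeaklyRegular_cons_iff]
    exact ⟨hreg, RingTheory.Sequence.IsWeaklyRegular.nil _ _⟩
  · have h1 : Ideal.Quotient.mk (edgeIdeal K H ^ k) 1 ∈
        Ideal.ofList [f] • (⊤ : Submodule (MvPolynomial V K)
          (MvPolynomial V K ⧸ edgeIdeal K H ^ k)) := htop ▸ trivial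
    rw [Ideal.ofList_singleton, Submodule.ideal_span_singleton_smul,
      Submodule.mem_smul_pointwise_iff_exists] at h1
    obtain ⟨g, -, hg⟩ := h1
    obtain ⟨p, rfl⟩ := Ideal.Quotient.mk_surjective g
    have hmem : f * p - 1 ∈ edgeIdeal K H ^ k := Ideal.Quotient.eq.1 hg
    have hmem' := edgeIdeal_le_maxIdeal (Ideal.pow_le_self hk hmem)
    simpa using Ideal.sub_mem _ (Ideal.mul_mem_right p _ hf) hmem'

end EdgeIdealDepth

section Walk

variable {V R : Type*} [CommRing R] {G : SimpleGraph V} {x : V → R} {w : Sym2 V → R} {I : Ideal R}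

theorem SimpleGraph.Walk.prod_edges_mul_mem_pow (hI : ∀ i j, G.Adj i j → x i * x j ∈ I)
    (hw : ∀ i j, w s(i, j) = x i * x j) {i j : V} (p : G.Walk i j) :
    (Even p.length → ∀ z, z * x i ∈ I →
      z * (p.edges.map w).prod * x j ∈ I ^ (p.length + 1)) ∧
    (Odd p.length → x i * (p.edges.map w).prod * x j ∈ I ^ (p.length + 1)) := by
  induction p with
  | nil => simp
  | @cons i i' j h q ih =>
    simp only [edges_cons, List.map_cons, List.prod_cons, hw, length_cons, pow_succ' I (_ + 1)]
    refine ⟨fun hp z hz => ?_, fun hp => ?_⟩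
    · have hq : Odd q.length := by simpa [Nat.even_add_one] using hp
      have := Ideal.mul_mem_mul hz (ih.2 hq)
      convert this using 1
      ring
    · have hq : Even q.length := by simpa [Nat.odd_add_one] using hp
      have := Ideal.mul_mem_mul (hI _ _ h) (ih.1 hq (x i) (hI _ _ h))
      convert this using 1
      ring

theorem SimpleGraph.Walk.prod_edges_mul_mem_pow_of_odd (hI : ∀ i j, G.Adj i j → x i * x j ∈ I)
    (hw : ∀ i j, w s(i, j) = x i * x j) {i j : V} (p : G.Walk i j) (hp : Odd p.length)
    {z z' : R} (hz : z * x i ∈ I) (hz' : z' * x j ∈ I) :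
    z * (p.edges.map w).prod * z' ∈ I ^ (p.length + 1) := by
  cases p with
  | nil => simp at hp
  | @cons _ i' _ h q =>
    simp only [edges_cons, List.map_cons, List.prod_cons, hw, length_cons, pow_succ' I (_ + 1)]
    have hq : Even q.length := by simpa [Nat.odd_add_one] using hp
    have := Ideal.mul_mem_mul hz
      ((q.reverse.prod_edges_mul_mem_pow hI hw).1 (by simpa using hq) z' hz')
    rw [edges_reverse, List.map_reverse, List.prod_reverse, length_reverse] at this
    convert this using 1
    ring

end Walk

section Whisker

variable {V : Type*}

/-- The whisker graph of `G`: a new leaf `Sum.inr i` is attached to every vertex `Sum.inl i`. -/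
def whiskerGraph (G : SimpleGraph V) : SimpleGraph (V ⊕ V) where
  Adj
    | .inl i, .inl j => G.Adj i j
    | .inl i, .inr j => i = j
    | .inr i, .inl j => i = j
    | .inr _, .inr _ => False
  symm := ⟨by
    rintro (i | i) (j | j) h
    · exact G.adj_symm h
    · exact h.symm
    · exact h.symm
    · exact h⟩
  loopless := ⟨by
    rintro (i | i) h
    · exact G.loopless.irrefl i h
    · exact h⟩

variable {G : SimpleGraph V}

/-- The extension of a two-colouring of `G` to the whisker graph of `G`. -/
def whiskerColoring (c : G.Coloring Bool) : (whiskerGraph G).Coloring Bool :=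
  SimpleGraph.Coloring.mk (Sum.elim c fun i => !c i) <| by
    rintro (i | i) (j | j) h
    · exact c.valid h
    · obtain rfl : i = j := h
      simp
    · obtain rfl : i = j := h
      simp
    · exact h.elim

theorem whiskerColoring_inl (c : G.Coloring Bool) (i : V) :
    whiskerColoring c (.inl i) = c i := rfl

theorem whiskerColoring_inr (c : G.Coloring Bool) (i : V) :
    whiskerColoring c (.inr i) = !c i := rfl

theorem whiskerEdgeIdeal_eq_edgeIdeal {n : ℕ} (K : Type*) [Field K]
    (G : SimpleGraph (Fin n)) : whiskerEdgeIdeal K G = edgeIdeal K (whiskerGraph G) := by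
  apply le_antisymm <;> rw [whiskerEdgeIdeal, edgeIdeal, Ideal.span_le]
  · rintro _ (⟨i, j, h, rfl⟩ | ⟨i, rfl⟩)
    · exact Ideal.subset_span ⟨.inl i, .inl j, h, rfl⟩
    · exact Ideal.subset_span ⟨.inl i, .inr i, rfl, rfl⟩
  · rintro _ ⟨i | i, j | j, h, rfl⟩
    · exact Ideal.subset_span (.inl ⟨i, j, h, rfl⟩)
    · obtain rfl : i = j := h
      exact Ideal.subset_span (.inr ⟨i, rfl⟩)
    · obtain rfl : i = j := h
      exact Ideal.subset_span (.inr ⟨i, mul_comm _ _⟩)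
    · exact h.elim

/-- The exponent of the monomial `x_i x_j` attached to an unordered pair `{i, j}`. -/
noncomputable def sym2Exponent (e : Sym2 V) : V ⊕ V →₀ ℕ :=
  Sym2.lift ⟨fun i j => Finsupp.single (.inl i) 1 + Finsupp.single (.inl j) 1,
    fun _ _ => add_comm _ _⟩ e

variable {K : Type*} [Field K]

theorem monomial_sym2Exponent (i j : V) :
    monomial (sym2Exponent s(i, j)) (1 : K) = X (.inl i) * X (.inl j) := by
  simp [sym2Exponent, X, monomial_mul]

theorem monomial_sym2Exponent_mem {e : Sym2 V} (he : e ∈ G.edgeSet) :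
    monomial (sym2Exponent e) (1 : K) ∈ edgeIdeal K (whiskerGraph G) := by
  induction e with
  | _ i j =>
    rw [monomial_sym2Exponent]
    exact X_mul_X_mem_edgeIdeal (H := whiskerGraph G) (a := .inl i) (b := .inl j) he

theorem X_inr_mul_X_inl_mem (i : V) :
    (X (.inr i) * X (.inl i) : MvPolynomial (V ⊕ V) K) ∈ edgeIdeal K (whiskerGraph G) :=
  X_mul_X_mem_edgeIdeal (H := whiskerGraph G) (a := .inr i) (b := .inl i) rfl

theorem X_mul_prod_edges_mul_X_mem (c : G.Coloring Bool) {a b : V ⊕ V}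
    (hab : whiskerColoring c a ≠ whiskerColoring c b)
    (p : G.Walk (a.elim id id) (b.elim id id)) :
    X a * (p.edges.map fun e => monomial (sym2Exponent e) (1 : K)).prod * X b ∈
      edgeIdeal K (whiskerGraph G) ^ (p.length + 1) := by
  have hI (i j : V) (h : G.Adj i j) :
      (X (.inl i) * X (.inl j) : MvPolynomial (V ⊕ V) K) ∈ edgeIdeal K (whiskerGraph G) :=
    X_mul_X_mem_edgeIdeal (H := whiskerGraph G) (a := .inl i) (b := .inl j) h
  have hw (i j : V) : monomial (sym2Exponent s(i, j)) (1 : K) = X (.inl i) * X (.inl j) :=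
    monomial_sym2Exponent i j
  have heven := c.even_length_iff_congr p
  have hodd := c.odd_length_iff_not_congr p
  rcases a with i | i <;> rcases b with j | j <;>
    simp only [whiskerColoring_inl, whiskerColoring_inr, Sum.elim_inl, Sum.elim_inr, id] at *
  · exact (p.prod_edges_mul_mem_pow (w := fun e => monomial (sym2Exponent e) 1) hI hw).2
      (hodd.2 (by grind))
  · have := (p.reverse.prod_edges_mul_mem_pow (w := fun e => monomial (sym2Exponent e) 1) hI hw).1
      (by rw [SimpleGraph.Walk.length_reverse]; exact heven.2 (by grind)) _ (X_inr_mul_X_inl_mem j)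
    rw [SimpleGraph.Walk.edges_reverse, List.map_reverse, List.prod_reverse,
      SimpleGraph.Walk.length_reverse] at this
    rw [mul_right_comm, mul_comm (X (Sum.inl i)), mul_right_comm]
    exact this
  · exact (p.prod_edges_mul_mem_pow (w := fun e => monomial (sym2Exponent e) 1) hI hw).1
      (heven.2 (by grind)) _ (X_inr_mul_X_inl_mem i)
  · exact p.prod_edges_mul_mem_pow_of_odd (w := fun e => monomial (sym2Exponent e) 1) hI hw
      (hodd.2 (by grind)) (X_inr_mul_X_inl_mem i) (X_inr_mul_X_inl_mem j)

theorem sum_sym2Exponent [Fintype V] (c : G.Coloring Bool) {e : Sym2 V} (he : e ∈ G.edgeSet)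
    (i : Bool) :
    ∑ v with whiskerColoring c v = i, sym2Exponent e v = 1 := by
  classical
  induction e with
  | _ a b =>
    have hab := c.valid he
    simp only [sym2Exponent, Sym2.lift_mk, Finsupp.add_apply, Finset.sum_add_distrib,
      Finsupp.single_apply, Finset.sum_ite_eq, Finset.mem_filter, Finset.mem_univ, true_and,
      whiskerColoring_inl]
    revert hab
    cases c a <;> cases c b <;> cases i <;> simp

/-- The exponent of the product of all edges of a subgraph `T` and of the `r`-th power of the
whisker at `i`. -/
noncomputable def treeExponent (T : SimpleGraph V) [Fintype T.edgeSet] (i : V) (r : ℕ) :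
    V ⊕ V →₀ ℕ :=
  ∑ e ∈ T.edgeFinset, sym2Exponent e +
    r • (Finsupp.single (.inl i) 1 + Finsupp.single (.inr i) 1)

theorem sum_treeExponent [Fintype V] (c : G.Coloring Bool) {T : SimpleGraph V}
    [Fintype T.edgeSet] (hTG : T ≤ G) (i : V) (r : ℕ) (k : Bool) :
    ∑ v with whiskerColoring c v = k, treeExponent T i r v = T.edgeFinset.card + r := by
  classical
  simp only [treeExponent, Finsupp.add_apply, Finsupp.smul_apply, Finsupp.finsetSum_apply,
    Finset.sum_add_distrib, smul_eq_mul, ← Finset.mul_sum]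
  congr 1
  · rw [Finset.sum_comm, Finset.card_eq_sum_ones]
    refine Finset.sum_congr rfl fun e he => sum_sym2Exponent c ?_ k
    exact SimpleGraph.edgeSet_mono hTG (SimpleGraph.mem_edgeFinset.1 he)
  · simp only [Finsupp.single_apply, Finset.sum_ite_eq, Finset.mem_filter, Finset.mem_univ,
      true_and, whiskerColoring_inl, whiskerColoring_inr]
    cases c i <;> cases k <;> simp

theorem X_mul_X_mul_monomial_treeExponent_mem (c : G.Coloring Bool) {T : SimpleGraph V}
    [Fintype T.edgeSet] (hT : T.IsTree) (hTG : T ≤ G) (i : V) (r : ℕ) {a b : V ⊕ V}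
    (hab : whiskerColoring c a ≠ whiskerColoring c b) :
    X a * X b * monomial (treeExponent T i r) (1 : K) ∈
      edgeIdeal K (whiskerGraph G) ^ (T.edgeFinset.card + 1 + r) := by
  classical
  obtain ⟨p, hp⟩ := hT.connected.exists_isPath (a.elim id id) (b.elim id id)
  have hsub : p.edges.toFinset ⊆ T.edgeFinset := fun e he =>
    SimpleGraph.mem_edgeFinset.2 (p.edges_subset_edgeSet (List.mem_toFinset.1 he))
  have hnodup := hp.isTrail.edges_nodup
  have hcard : (T.edgeFinset \ p.edges.toFinset).card + p.length = T.edgeFinset.card := by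
    rw [← Finset.card_sdiff_add_card_eq_card hsub, List.toFinset_card_of_nodup hnodup,
      SimpleGraph.Walk.length_edges]
  have hprod : monomial (treeExponent T i r) (1 : K) =
      (∏ e ∈ T.edgeFinset \ p.edges.toFinset, monomial (sym2Exponent e) (1 : K)) *
        (p.edges.map fun e => monomial (sym2Exponent e) (1 : K)).prod *
        (X (.inr i) * X (.inl i)) ^ r := by
    rw [← List.prod_toFinset _ hnodup, Finset.prod_sdiff hsub, ← monomial_sum_one]
    simp only [treeExponent, X, monomial_mul, monomial_pow, mul_one, one_pow,
      add_comm (Finsupp.single (Sum.inr i) 1)]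
  have hpath := X_mul_prod_edges_mul_X_mem (K := K) c hab (p.mapLe hTG)
  rw [SimpleGraph.Walk.edges_mapLe_eq_edges, SimpleGraph.Walk.length_map] at hpath
  have hrest : ∏ e ∈ T.edgeFinset \ p.edges.toFinset, monomial (sym2Exponent e) (1 : K) ∈
      edgeIdeal K (whiskerGraph G) ^ (T.edgeFinset \ p.edges.toFinset).card := by
    rw [← Finset.prod_const]
    refine Ideal.prod_mem_prod fun e he => monomial_sym2Exponent_mem ?_
    exact SimpleGraph.edgeSet_mono hTG (SimpleGraph.mem_edgeFinset.1 (Finset.mem_sdiff.1 he).1)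
  have hall := Ideal.mul_mem_mul (Ideal.mul_mem_mul hrest hpath)
    (Ideal.pow_mem_pow (X_inr_mul_X_inl_mem (K := K) (G := G) i) r)
  rw [← pow_add, ← pow_add, ← add_assoc, hcard] at hall
  rw [hprod]
  convert hall using 1
  ring

end Whisker

/-- Herzog–Hibi–Qureshi, Corollary (bipartite case): if `G` is a finite simple connected
bipartite graph on `n` vertices, then `depth(S*/I(G*)^k) = 1` for all `k ≥ n`. -/
theorem depth_whisker_power_eq_one_of_bipartite {n : ℕ} (K : Type*) [Field K]
    (G : SimpleGraph (Fin n)) (hG : G.Connected) (hbip : G.Colorable 2)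
    (k : ℕ) (hk : n ≤ k) :
    idealDepth (maxIdeal (Fin n ⊕ Fin n) K)
      (MvPolynomial (Fin n ⊕ Fin n) K ⧸ (whiskerEdgeIdeal K G) ^ k) = 1 := by
  classical
  obtain ⟨i⟩ := hG.nonempty
  have c : G.Coloring Bool := hbip.toColoring (by simp)
  obtain ⟨T, hTG, hT⟩ := hG.exists_isTree_le
  have hcard := hT.card_edgeFinset
  rw [Fintype.card_fin] at hcard
  rw [whiskerEdgeIdeal_eq_edgeIdeal]
  refine IsGreatest.csSup_eq ⟨?_, ?_⟩
  · obtain ⟨f, hf, hreg⟩ := exists_isRegular_singleton_of_leaf (K := K) (whiskerColoring c)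
      (x := .inl i) (y := .inr i) (k := k) rfl
      (by
        rintro (j | j) h
        · exact congrArg Sum.inl h
        · exact h.elim)
      (by omega)
    exact ⟨[f], rfl, by simpa using hf, hreg⟩
  · rintro d ⟨rs, rfl, hmem, hreg⟩
    by_contra! hlen
    match rs, hlen with
    | f₁ :: f₂ :: rs, _ =>
      obtain ⟨a, b, ha, hb⟩ : ∃ a b, whiskerColoring c a = true ∧ whiskerColoring c b = false := by
        cases h : c i
        · exact ⟨.inr i, .inl i, by simp [whiskerColoring_inr, h], h⟩
        · exact ⟨.inl i, .inr i, h, by simp [whiskerColoring_inr, h]⟩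
      refine not_isWeaklyRegular_of_monomial (whiskerColoring c) (u := treeExponent T i (k - n))
        (fun j => ?_) (fun a b ha hb => ?_) ha hb (hmem f₁ (by simp)) (hmem f₂ (by simp))
        hreg.toIsWeaklyRegular
      · rw [sum_treeExponent c hTG]
        omega
      · have := X_mul_X_mul_monomial_treeExponent_mem (K := K) c hT hTG i (k - n)
          (a := a) (b := b) (by simp [ha, hb])
        rwa [hcard, Nat.add_sub_cancel' hk] at this
end

section
/- Let G be a finite simple graph on {1,...,n} and G* its whisker graph. Then the ring S*/I(G*) is Cohen–Macaulay of Krull dimension n, where S* = K[x_1,...,x_n,y_1,...,y_n] and I(G*) is the edge ideal of G*. -/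
open MvPolynomial

section RegularSequence

variable {R : Type*} [CommRing R]

/-- Over a Noetherian ring, the length of a regular sequence on a finite module is at most the
dimension of the support of the module. -/
theorem length_le_supportDim_of_isRegular [IsNoetherianRing R] {M : Type*} [AddCommGroup M]
    [Module R M] [Module.Finite R M] (rs : List R) (reg : RingTheory.Sequence.IsRegular M rs) :
    (rs.length : WithBot ℕ∞) ≤ Module.supportDim R M := by
  induction rs generalizing M with
  | nil =>
    have : Nontrivial M := reg.nontrivial
    have h := (Module.supportDim_ne_bot_iff_nontrivial R M).mpr this
    rw [← WithBot.coe_unbot _ h]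
    exact WithBot.coe_le_coe.mpr zero_le
  | cons x rs ih =>
    obtain ⟨hx, hrs⟩ := (RingTheory.Sequence.isRegular_cons_iff M _ _).mp reg
    have h := Module.supportDim_quotSMulTop_succ_le_of_notMem_minimalPrimes (M := M) (x := x)
      fun _ ↦ hx.notMem_of_mem_minimalPrimes
    refine le_trans ?_ h
    rw [List.length_cons, Nat.cast_succ]
    gcongr
    exact ih hrs

theorem mk_mem_smul_top_iff (I J : Ideal R) (f : R) :
    Ideal.Quotient.mk I f ∈ (J • ⊤ : Submodule R (R ⧸ I)) ↔ f ∈ I ⊔ J := by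
  rw [Ideal.smul_top_eq_map, Submodule.restrictScalars_mem, Ideal.Quotient.algebraMap_eq,
    ← Ideal.mem_comap, Ideal.comap_map_of_surjective _ Ideal.Quotient.mk_surjective,
    ← RingHom.ker_eq_comap_bot, Ideal.mk_ker, sup_comm]

theorem isSMulRegular_quotient_smul_top_iff (I J : Ideal R) (r : R) :
    IsSMulRegular ((R ⧸ I) ⧸ (J • ⊤ : Submodule R (R ⧸ I))) r ↔
      ∀ f, r * f ∈ I ⊔ J → f ∈ I ⊔ J := by
  rw [isSMulRegular_quotient_iff_mem_of_smul_mem, Ideal.Quotient.mk_surjective.forall]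
  refine forall_congr' fun f ↦ ?_
  rw [← mk_mem_smul_top_iff, ← mk_mem_smul_top_iff]
  rfl

end RegularSequence

/-- Krull dimension does not increase along an integral ring extension. -/
theorem ringKrullDim_le_of_isIntegral (A B : Type*) [CommRing A] [CommRing B] [Algebra A B]
    [Algebra.IsIntegral A B] : ringKrullDim B ≤ ringKrullDim A :=
  Order.krullDim_le_of_strictMono (PrimeSpectrum.comap (algebraMap A B)) fun _ _ h ↦
    Ideal.IsIntegral.comap_lt_comap (R := A) h

/-- Let `E` generate a monomial ideal which contains `X a * X b`, all of whose generators have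
degree at most one in `X a`, and such that every generator involving `X b` also involves `X a`.
Then `X b - X a` is a nonzerodivisor modulo this ideal. -/
theorem mem_span_monomial_of_X_sub_X_mul_mem {σ R : Type*} [CommRing R]
    {E : Set (σ →₀ ℕ)} {a b : σ} (hab : a ≠ b)
    (hE : Finsupp.single a 1 + Finsupp.single b 1 ∈ E)
    (ha : ∀ e ∈ E, e a ≤ 1) (hb : ∀ e ∈ E, e a = 0 → e b = 0) {g : MvPolynomial σ R}
    (hg : (X b - X a) * g ∈ Ideal.span ((fun s ↦ monomial s (1 : R)) '' E)) :
    g ∈ Ideal.span ((fun s ↦ monomial s (1 : R)) '' E) := by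
  classical
  rw [mem_ideal_span_monomial_image] at hg ⊢
  intro m hm
  by_contra! hmE
  rw [mem_support_iff] at hm
  by_cases hma : m a = 0
  · obtain ⟨e, he, hle⟩ := hg (Finsupp.single b 1 + m) <| by
      rw [mem_support_iff, sub_mul, coeff_sub, coeff_X_mul, coeff_X_mul', if_neg, sub_zero]
      · exact hm
      · simp [hma, hab]
    have hea : e a = 0 := by simpa [hma, hab] using hle a
    refine hmE e he fun i ↦ ?_
    by_cases hi : i = b
    · simp [hi, hb e he hea]
    · simpa [Finsupp.single_apply, Ne.symm hi] using hle i
  · have hmb : m b = 0 := by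
      by_contra hmb
      refine hmE _ hE fun i ↦ ?_
      simp only [Finsupp.add_apply, Finsupp.single_apply]
      grind
    obtain ⟨e, he, hle⟩ := hg (Finsupp.single a 1 + m) <| by
      rw [mem_support_iff, sub_mul, coeff_sub, coeff_X_mul, coeff_X_mul', if_neg, zero_sub]
      · exact neg_ne_zero.mpr hm
      · simp [hmb, hab.symm]
    refine hmE e he fun i ↦ ?_
    by_cases hi : i = a
    · subst hi
      exact (ha e he).trans (Nat.one_le_iff_ne_zero.mpr hma)
    · simpa [Finsupp.single_apply, Ne.symm hi] using hle i

section Whisker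

variable {n : ℕ} {K : Type*} [Field K]

/-- The variable `x_i` if `i ∈ s`, and `y_i` otherwise. -/
noncomputable def collapseIndex (s : Set (Fin n)) (i : Fin n) : Fin n ⊕ Fin n :=
  open Classical in if i ∈ s then Sum.inl i else Sum.inr i

/-- The substitution `y_i ↦ x_i` for `i ∈ s`. -/
noncomputable def collapse (K : Type*) [Field K] (s : Set (Fin n)) :
    MvPolynomial (Fin n ⊕ Fin n) K →ₐ[K] MvPolynomial (Fin n ⊕ Fin n) K :=
  rename (Sum.elim Sum.inl (collapseIndex s))

/-- The linear form `y_i - x_i`. -/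
noncomputable def whiskerForm (K : Type*) [Field K] (i : Fin n) :
    MvPolynomial (Fin n ⊕ Fin n) K :=
  X (Sum.inr i) - X (Sum.inl i)

/-- The exponents of the generators of the image of the whisker edge ideal under `collapse K s`. -/
def collapseExponents (G : SimpleGraph (Fin n)) (s : Set (Fin n)) : Set (Fin n ⊕ Fin n →₀ ℕ) :=
  {e | ∃ i j, G.Adj i j ∧ e = Finsupp.single (Sum.inl i) 1 + Finsupp.single (Sum.inl j) 1} ∪
    Set.range fun i ↦ Finsupp.single (Sum.inl i) 1 + Finsupp.single (collapseIndex s i) 1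

theorem map_collapse_whiskerEdgeIdeal (G : SimpleGraph (Fin n)) (s : Set (Fin n)) :
    (whiskerEdgeIdeal K G).map (collapse K s) =
      Ideal.span ((fun e ↦ monomial e (1 : K)) '' collapseExponents G s) := by
  have hmul (u v : Fin n ⊕ Fin n) : (X u * X v : MvPolynomial (Fin n ⊕ Fin n) K) =
      monomial (Finsupp.single u 1 + Finsupp.single v 1) 1 := by
    simp [X, monomial_mul]
  rw [whiskerEdgeIdeal, Ideal.map_span, collapseExponents, Set.image_union, Set.image_union]
  congr 2
  · ext p
    constructor
    · rintro ⟨_, ⟨i, j, hij, rfl⟩, rfl⟩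
      exact ⟨_, ⟨i, j, hij, rfl⟩, by simp [collapse, ← hmul]⟩
    · rintro ⟨_, ⟨i, j, hij, rfl⟩, rfl⟩
      exact ⟨_, ⟨i, j, hij, rfl⟩, by simp [collapse, ← hmul]⟩
  · rw [← Set.range_comp, ← Set.range_comp]
    congr 1
    ext1 i
    simp [collapse, ← hmul]

theorem sub_collapse_mem_span (s : Set (Fin n)) (f : MvPolynomial (Fin n ⊕ Fin n) K) :
    f - collapse K s f ∈ Ideal.span (whiskerForm K '' s) := by
  set Z := Ideal.span (whiskerForm K '' s)
  rw [← Ideal.Quotient.eq]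
  suffices h : Ideal.Quotient.mkₐ K Z = (Ideal.Quotient.mkₐ K Z).comp (collapse K s) from
    DFunLike.congr_fun h f
  ext (i | i)
  · simp [collapse]
  · by_cases hi : i ∈ s
    · simp only [collapse, AlgHom.comp_apply, rename_X, Sum.elim_inr, collapseIndex, if_pos hi]
      exact Ideal.Quotient.eq.mpr (Ideal.subset_span ⟨i, hi, rfl⟩)
    · simp [collapse, collapseIndex, hi]

theorem mem_of_whiskerForm_mul_mem (G : SimpleGraph (Fin n)) (s : Set (Fin n)) {k : Fin n}
    (hk : k ∉ s) {f : MvPolynomial (Fin n ⊕ Fin n) K}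
    (hf : whiskerForm K k * f ∈ whiskerEdgeIdeal K G ⊔ Ideal.span (whiskerForm K '' s)) :
    f ∈ whiskerEdgeIdeal K G ⊔ Ideal.span (whiskerForm K '' s) := by
  have hZ : (Ideal.span (whiskerForm K '' s)).map (collapse K s) = ⊥ := by
    rw [Ideal.map_span, Ideal.span_eq_bot]
    rintro _ ⟨_, ⟨i, hi, rfl⟩, rfl⟩
    simp [collapse, whiskerForm, collapseIndex, hi]
  have hle : (whiskerEdgeIdeal K G).map (collapse K s) ≤
      whiskerEdgeIdeal K G ⊔ Ideal.span (whiskerForm K '' s) := by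
    refine Ideal.map_le_iff_le_comap.mpr fun g hg ↦ ?_
    rw [Ideal.mem_comap, ← sub_sub_cancel g (collapse K s g)]
    exact sub_mem (Ideal.mem_sup_left hg) (Ideal.mem_sup_right (sub_collapse_mem_span s g))
  have hmap := Ideal.mem_map_of_mem (collapse K s) hf
  have hform : collapse K s (whiskerForm K k) = X (Sum.inr k) - X (Sum.inl k) := by
    simp [collapse, whiskerForm, collapseIndex, hk]
  rw [Ideal.map_sup, hZ, sup_bot_eq, map_mul, hform, map_collapse_whiskerEdgeIdeal] at hmap
  have hmem : collapse K s f ∈ (whiskerEdgeIdeal K G).map (collapse K s) := by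
    rw [map_collapse_whiskerEdgeIdeal]
    refine mem_span_monomial_of_X_sub_X_mul_mem Sum.inl_ne_inr
      (Or.inr ⟨k, by simp [collapseIndex, hk]⟩) ?_ ?_ hmap
    · rintro _ (⟨i, j, hij, rfl⟩ | ⟨i, rfl⟩)
      · have := hij.ne
        simp only [Finsupp.add_apply, Finsupp.single_apply, Sum.inl.injEq]
        grind
      · simp only [collapseIndex, Finsupp.add_apply, Finsupp.single_apply, Sum.inl.injEq]
        grind
    · rintro _ (⟨i, j, hij, rfl⟩ | ⟨i, rfl⟩)
      · simp
      · simp only [collapseIndex, Finsupp.add_apply, Finsupp.single_apply, Sum.inl.injEq]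
        grind
  rw [← sub_add_cancel f (collapse K s f)]
  exact add_mem (Ideal.mem_sup_right (sub_collapse_mem_span s f)) (hle hmem)

theorem whiskerForm_mem_maxIdeal (i : Fin n) :
    whiskerForm K i ∈ maxIdeal (Fin n ⊕ Fin n) K :=
  sub_mem (Ideal.subset_span ⟨_, rfl⟩) (Ideal.subset_span ⟨_, rfl⟩)

theorem whiskerEdgeIdeal_le_maxIdeal (G : SimpleGraph (Fin n)) :
    whiskerEdgeIdeal K G ≤ maxIdeal (Fin n ⊕ Fin n) K := by
  refine Ideal.span_le.mpr ?_
  rintro _ (⟨i, j, -, rfl⟩ | ⟨i, rfl⟩) <;>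
    exact Ideal.mul_mem_right _ _ (Ideal.subset_span ⟨_, rfl⟩)

theorem maxIdeal_ne_top (σ : Type*) : maxIdeal σ K ≠ ⊤ := by
  intro h
  have hle : maxIdeal σ K ≤ RingHom.ker (constantCoeff (σ := σ) (R := K)) := by
    refine Ideal.span_le.mpr ?_
    rintro _ ⟨i, rfl⟩
    simp
  exact RingHom.ker_ne_top _ (top_le_iff.mp (h ▸ hle))

theorem isRegular_whiskerForm (G : SimpleGraph (Fin n)) :
    RingTheory.Sequence.IsRegular (MvPolynomial (Fin n ⊕ Fin n) K ⧸ whiskerEdgeIdeal K G)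
      (List.ofFn (whiskerForm (n := n) K)) := by
  refine ⟨(RingTheory.Sequence.isWeaklyRegular_iff_Fin _ _).mpr fun i ↦ ?_, fun h ↦ ?_⟩
  · have hi : i.1 < n := by simpa using i.2
    have hspan : Ideal.ofList ((List.ofFn (whiskerForm (n := n) K)).take i) =
        Ideal.span (whiskerForm K '' {j : Fin n | j < ⟨i, hi⟩}) := by
      rw [Ideal.ofList]
      congr 1
      ext r
      simp only [Set.mem_ofPred_eq, List.mem_take_iff_getElem, Set.mem_image]
      constructor
      · rintro ⟨j, hj, rfl⟩
        simp only [List.length_ofFn, lt_min_iff] at hj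
        exact ⟨⟨j, hj.2⟩, hj.1, by simp⟩
      · rintro ⟨j, hj, rfl⟩
        exact ⟨j, by simpa using Fin.lt_def.mp hj, by simp⟩
    rw [hspan, isSMulRegular_quotient_smul_top_iff]
    intro f hf
    refine mem_of_whiskerForm_mul_mem G _ (k := ⟨i, hi⟩) (by simp) ?_
    simpa using hf
  · have hone := (mk_mem_smul_top_iff (whiskerEdgeIdeal K G)
      (Ideal.ofList (List.ofFn (whiskerForm (n := n) K))) 1).mp (h ▸ Submodule.mem_top)
    refine maxIdeal_ne_top (K := K) (Fin n ⊕ Fin n) ((Ideal.eq_top_iff_one _).mpr ?_)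
    refine sup_le (whiskerEdgeIdeal_le_maxIdeal G) (Ideal.span_le.mpr ?_) hone
    intro r hr
    obtain ⟨i, rfl⟩ := (List.mem_ofFn' _ _).mp hr
    exact whiskerForm_mem_maxIdeal i

theorem ringKrullDim_whisker_le (G : SimpleGraph (Fin n)) :
    ringKrullDim (MvPolynomial (Fin n ⊕ Fin n) K ⧸ whiskerEdgeIdeal K G) ≤ n := by
  set B := MvPolynomial (Fin n ⊕ Fin n) K ⧸ whiskerEdgeIdeal K G
  let π : MvPolynomial (Fin n ⊕ Fin n) K →ₐ[K] B := Ideal.Quotient.mkₐ K _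
  let φ : MvPolynomial (Fin n) K →ₐ[K] B := aeval fun i ↦ π (X (Sum.inl i) + X (Sum.inr i))
  algebraize [φ.toRingHom]
  have hroot (i : Fin n) : π (X (Sum.inl i)) * π (X (Sum.inr i)) = 0 := by
    rw [← map_mul]
    exact Ideal.Quotient.eq_zero_iff_mem.mpr (Ideal.subset_span (Or.inr ⟨i, rfl⟩))
  have hφ (i : Fin n) : algebraMap (MvPolynomial (Fin n) K) B (X i) =
      π (X (Sum.inl i)) + π (X (Sum.inr i)) := by
    rw [← map_add]
    exact aeval_X _ i
  have hinl (i : Fin n) : IsIntegral (MvPolynomial (Fin n) K) (π (X (Sum.inl i))) := by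
    refine ⟨Polynomial.X ^ 2 - Polynomial.C (X i) * Polynomial.X, by monicity!, ?_⟩
    simp only [Polynomial.eval₂_sub, Polynomial.eval₂_mul, Polynomial.eval₂_pow,
      Polynomial.eval₂_X, Polynomial.eval₂_C, hφ]
    linear_combination -hroot i
  have hinr (i : Fin n) : IsIntegral (MvPolynomial (Fin n) K) (π (X (Sum.inr i))) := by
    rw [← add_sub_cancel_left (π (X (Sum.inl i))) (π (X (Sum.inr i))), ← hφ]
    exact isIntegral_algebraMap.sub (hinl i)
  have : Algebra.IsIntegral (MvPolynomial (Fin n) K) B := by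
    refine ⟨fun b ↦ ?_⟩
    obtain ⟨p, rfl⟩ := Ideal.Quotient.mkₐ_surjective K (whiskerEdgeIdeal K G) b
    change IsIntegral _ (π p)
    induction p using MvPolynomial.induction_on with
    | C a =>
      have : π (C a) = algebraMap (MvPolynomial (Fin n) K) B (C a) :=
        (π.commutes a).trans (φ.commutes a).symm
      rw [this]
      exact isIntegral_algebraMap
    | add p q hp hq => rw [map_add]; exact hp.add hq
    | mul_X p i hp =>
      rw [map_mul]
      exact hp.mul (i.casesOn hinl hinr)
  simpa using ringKrullDim_le_of_isIntegral (MvPolynomial (Fin n) K) B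

end Whisker

/-- Villarreal: for any finite simple graph `G` on `n` vertices, the ring `S*/I(G*)` of the
whisker graph is Cohen–Macaulay of Krull dimension `n`, i.e. its depth and its Krull
dimension are both equal to `n`. -/
theorem whisker_cohenMacaulay {n : ℕ} (K : Type*) [Field K] (G : SimpleGraph (Fin n)) :
    idealDepth (maxIdeal (Fin n ⊕ Fin n) K)
      (MvPolynomial (Fin n ⊕ Fin n) K ⧸ whiskerEdgeIdeal K G) = n ∧
    ringKrullDim (MvPolynomial (Fin n ⊕ Fin n) K ⧸ whiskerEdgeIdeal K G) = n := by
  have hlength (rs : List (MvPolynomial (Fin n ⊕ Fin n) K)) (hrs : RingTheory.Sequence.IsRegular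
      (MvPolynomial (Fin n ⊕ Fin n) K ⧸ whiskerEdgeIdeal K G) rs) : (rs.length : WithBot ℕ∞) ≤
      ringKrullDim (MvPolynomial (Fin n ⊕ Fin n) K ⧸ whiskerEdgeIdeal K G) := by
    rw [← Module.supportDim_quotient_eq_ringKrullDim]
    exact length_le_supportDim_of_isRegular rs hrs
  have hle := ringKrullDim_whisker_le (K := K) G
  refine ⟨IsGreatest.csSup_eq ⟨⟨_, by simp, ?_, isRegular_whiskerForm G⟩, ?_⟩,
    hle.antisymm (by simpa using hlength _ (isRegular_whiskerForm G))⟩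
  · intro r hr
    obtain ⟨i, rfl⟩ := (List.mem_ofFn' _ _).mp hr
    exact whiskerForm_mem_maxIdeal i
  · rintro _ ⟨rs, rfl, -, hrs⟩
    exact_mod_cast (hlength rs hrs).trans hle
end

section
/- Let G be the graph on vertex set {1,2,3,4} with edges {1,2} and {3,4} (a disjoint union of two edges), G* its whisker graph, and I(G*) ⊆ S* = K[x_1,...,x_4,y_1,...,y_4]. Then depth(S*/I(G*)^4) = 2; in particular the bound depth(S*/I(G*)^k) ≤ n − k + 1 of the connected case fails for disconnected graphs. -/
open MvPolynomial

/-- The graph on `{1,2,3,4}` whose only edges are `{1,2}` and `{3,4}`. -/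
def twoEdgesGraph : SimpleGraph (Fin 4) :=
  SimpleGraph.fromRel (fun a b => (a = 0 ∧ b = 1) ∨ (a = 2 ∧ b = 3))

universe u

section Depth
open CategoryTheory Abelian

theorem ext_quotSMulTop_subsingleton {R : Type u} [CommRing R] (N M : ModuleCat.{u} R) {r : R}
    (hr : IsSMulRegular M r) (i : ℕ) (h₀ : Subsingleton (Ext N M i))
    (h₁ : Subsingleton (Ext N M (i + 1))) :
    Subsingleton (Ext N (ModuleCat.of R (QuotSMulTop r M)) i) := by
  have zero₀ := AddCommGrpCat.isZero_of_iff_subsingleton.mpr h₀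
  have zero₁ := AddCommGrpCat.isZero_of_iff_subsingleton.mpr h₁
  exact AddCommGrpCat.subsingleton_of_isZero <| ShortComplex.Exact.isZero_of_both_zeros
    ((Ext.covariant_sequence_exact₃' N hr.smulShortComplex_shortExact) i (i + 1) rfl)
    (zero₀.eq_zero_of_src _) (zero₁.eq_zero_of_tgt _)

/-- If `f, g` is weakly regular on `M` and `M / (f, g) M` has a nonzero element killed by `I`, then
`M`-regular sequences in `I` have length at most two. -/
theorem length_le_two_of_socle {R : Type u} [CommRing R] [IsNoetherianRing R] (I : Ideal R)
    (M : Type u) [AddCommGroup M] [Module R M] [Module.Finite R M]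
    (hIM : I • (⊤ : Submodule R M) < ⊤) {f g : R} (hf : IsSMulRegular M f)
    (hg : IsSMulRegular (QuotSMulTop f M) g) {w : QuotSMulTop g (QuotSMulTop f M)} (hw : w ≠ 0)
    (hIw : ∀ r ∈ I, r • w = 0) {rs : List R} (hrs : ∀ r ∈ rs, r ∈ I)
    (hreg : RingTheory.Sequence.IsRegular M rs) : rs.length ≤ 2 := by
  by_contra! hlen
  let N := ModuleCat.of R (R ⧸ I)
  have hN : Module.support R N ⊆ PrimeSpectrum.zeroLocus I := by
    change Module.support R (R ⧸ I) ⊆ _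
    rw [Module.support_eq_zeroLocus, Ideal.annihilator_quotient]
  have : Module.Finite R N := inferInstanceAs (Module.Finite R (R ⧸ I))
  have : Module.Finite R (ModuleCat.of R M) := ‹Module.Finite R M›
  have hext := ModuleCat.subsingleton_ext_of_exists_isRegular I N hN (ModuleCat.of R M) hIM rs hrs
    hreg
  have h₀ := ext_quotSMulTop_subsingleton N (ModuleCat.of R M) hf 0 (hext 0 (by omega))
    (hext 1 (by omega))
  have h₁ := ext_quotSMulTop_subsingleton N (ModuleCat.of R M) hf 1 (hext 1 (by omega))
    (hext 2 (by omega))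
  have h := ext_quotSMulTop_subsingleton N (ModuleCat.of R (QuotSMulTop f M)) hg 0 h₀ h₁
  have h' : Subsingleton ((R ⧸ I) →ₗ[R] QuotSMulTop g (QuotSMulTop f M)) :=
    ((Ext.addEquiv₀ (X := N) (Y := ModuleCat.of R (QuotSMulTop g (QuotSMulTop f M)))).trans
      ModuleCat.homAddEquiv).symm.subsingleton
  let φ : (R ⧸ I) →ₗ[R] QuotSMulTop g (QuotSMulTop f M) :=
    Submodule.liftQ I (LinearMap.toSpanSingleton R _ w) (fun r hr => by simpa using hIw r hr)
  apply hw
  have : φ (Submodule.Quotient.mk 1) = 0 := by rw [Subsingleton.elim φ 0]; rfl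
  rwa [Submodule.liftQ_apply, LinearMap.toSpanSingleton_apply, one_smul] at this

end Depth

section Quotient
open scoped Pointwise

theorem ker_mkQ_smul_top_comp {R M : Type*} [CommRing R] [AddCommGroup M] [Module R M]
    {π : R →ₗ[R] M} (hπ : Function.Surjective π) (r : R) :
    LinearMap.ker ((r • (⊤ : Submodule R M)).mkQ ∘ₗ π) = LinearMap.ker π ⊔ Ideal.span {r} := by
  have : r • (⊤ : Submodule R M) = Submodule.map π (Ideal.span {r}) := by
    rw [← LinearMap.range_eq_top.mpr hπ, LinearMap.range_eq_map, ← Submodule.map_pointwise_smul,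
      ← Submodule.ideal_span_singleton_smul]
    simp
  rw [LinearMap.ker_comp, Submodule.ker_mkQ, this, Submodule.comap_map_eq, sup_comm]

theorem isSMulRegular_of_surjective {R M : Type*} [CommRing R] [AddCommGroup M] [Module R M]
    {π : R →ₗ[R] M} (hπ : Function.Surjective π) {r : R}
    (h : ∀ q, r * q ∈ LinearMap.ker π → q ∈ LinearMap.ker π) : IsSMulRegular M r := by
  refine (isSMulRegular_iff_right_eq_zero_of_smul).mpr fun x hx => ?_
  obtain ⟨q, rfl⟩ := hπ x
  exact h q (by rwa [LinearMap.mem_ker, ← smul_eq_mul, map_smul])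

theorem sup_pow_le {R : Type*} [CommRing R] (I J : Ideal R) (n : ℕ) :
    (I ⊔ J) ^ n ≤ I ^ n ⊔ J := by
  induction n with
  | zero => simp
  | succ n ih =>
    rw [pow_succ, pow_succ]
    refine (Ideal.mul_mono_left ih).trans ?_
    rw [Ideal.sup_mul, Ideal.mul_sup]
    refine sup_le (sup_le_sup le_rfl Ideal.mul_le_right) ?_
    exact le_sup_of_le_right Ideal.mul_le_left

end Quotient

section Monomial

theorem span_monomial_pow {σ R ι : Type*} [CommRing R] [Fintype ι] (e : ι → σ →₀ ℕ) (k : ℕ) :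
    Ideal.span (Set.range fun i => monomial (e i) (1 : R)) ^ k =
      Ideal.span ((fun s => monomial s (1 : R)) ''
        {s | ∃ c : ι → ℕ, ∑ i, c i = k ∧ ∑ i, c i • e i = s}) := by
  classical
  induction k with
  | zero =>
    rw [pow_zero, Ideal.one_eq_top, eq_comm, Ideal.eq_top_iff_one]
    exact Ideal.subset_span ⟨0, ⟨0, by simp, by simp⟩, rfl⟩
  | succ k ih =>
    rw [pow_succ, ih, Ideal.span_mul_span']
    congr 1
    ext p
    simp only [Set.mem_mul, Set.mem_image, Set.mem_ofPred_eq, Set.mem_range]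
    constructor
    · rintro ⟨_, ⟨_, ⟨c, hc, rfl⟩, rfl⟩, _, ⟨i, rfl⟩, rfl⟩
      refine ⟨_, ⟨c + Pi.single i 1, ?_, rfl⟩, ?_⟩
      · simp [Finset.sum_add_distrib, hc]
      · simp [Finset.sum_add_distrib, add_smul, Pi.single_apply, monomial_mul]
    · rintro ⟨_, ⟨c, hc, rfl⟩, rfl⟩
      obtain ⟨i, -, hi⟩ : ∃ i ∈ Finset.univ, c i ≠ 0 := by
        apply Finset.exists_ne_zero_of_sum_ne_zero; omega
      have hci : c = (c - Pi.single i 1) + Pi.single i 1 := by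
        ext j
        rcases eq_or_ne j i with rfl | hj
        · simp; omega
        · simp [hj]
      refine ⟨_, ⟨_, ⟨c - Pi.single i 1, ?_, rfl⟩, rfl⟩, _, ⟨i, rfl⟩, ?_⟩
      · rw [hci] at hc
        simpa [Finset.sum_add_distrib] using hc
      · conv_rhs => rw [hci]
        simp [Finset.sum_add_distrib, add_smul, Pi.single_apply, monomial_mul]

/-- Multiplication by `X a + X b` reflects having all exponents in an upward closed set that is
stable under lowering the exponent of `a`. -/
theorem support_of_support_add_mul {σ R : Type*} [CommRing R] {a b : σ} (hab : a ≠ b)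
    {E : (σ →₀ ℕ) → Prop} (hup : ∀ m, E m → E (m + Finsupp.single b 1))
    (hdown : ∀ m, E (m + Finsupp.single a 1) → E m) {p : MvPolynomial σ R}
    (hp : ∀ m ∈ ((X a + X b) * p).support, E m) : ∀ m ∈ p.support, E m := by
  classical
  by_contra! hne
  obtain ⟨m₀, hm₀, hE₀⟩ := hne
  obtain ⟨m, hm, hmax⟩ := Finset.exists_max_image (p.support.filter fun m => ¬ E m)
    (fun m => m a) ⟨m₀, by simp [hE₀] at hm₀ ⊢; exact hm₀⟩
  simp only [Finset.mem_filter] at hm hmax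
  refine hm.2 (hdown m ?_)
  have hcoeff : coeff (m + Finsupp.single a 1) ((X a + X b) * p) = coeff m p +
      if b ∈ (m + Finsupp.single a 1).support then
        coeff (m + Finsupp.single a 1 - Finsupp.single b 1) p else 0 := by
    rw [add_mul, coeff_add, mul_comm (X a), coeff_mul_X, mul_comm (X b), coeff_mul_X']
  by_cases hz : E (m + Finsupp.single a 1)
  · exact hz
  have h0 : coeff (m + Finsupp.single a 1) ((X a + X b) * p) = 0 := by
    by_contra h
    exact hz (hp _ (mem_support_iff.mpr h))
  rw [h0] at hcoeff
  split_ifs at hcoeff with hb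
  · set m' := m + Finsupp.single a 1 - Finsupp.single b 1 with hm'
    have hle : Finsupp.single b 1 ≤ m + Finsupp.single a 1 := by
      rw [Finsupp.single_le_iff]
      exact Nat.one_le_iff_ne_zero.mpr (Finsupp.mem_support_iff.mp hb)
    have hmm : m' + Finsupp.single b 1 = m + Finsupp.single a 1 := tsub_add_cancel_of_le hle
    have hE' : E m' := by
      by_contra hE'
      have hs : m' ∈ p.support := by
        rw [mem_support_iff]
        intro h
        exact mem_support_iff.mp hm.1 (by simpa [h] using hcoeff.symm)
      have := hmax m' ⟨hs, hE'⟩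
      have h2 := DFunLike.congr_fun hmm a
      simp [hab] at h2
      omega
    exact hmm ▸ hup _ hE'
  · exact absurd (by simpa using hcoeff.symm) (mem_support_iff.mp hm.1)

end Monomial

section Path

/-- A path on four vertices with edge multiplicities `x, y, z` fitting below given vertex
multiplicities. -/
theorem exists_path_multiplicities {α β γ δ k : ℕ} (h₁ : k ≤ β + γ) (h₂ : k ≤ β + δ)
    (h₃ : k ≤ α + γ) :
    ∃ x y z, x + y + z = k ∧ x ≤ α ∧ x + y ≤ β ∧ y + z ≤ γ ∧ z ≤ δ := by
  obtain ⟨x, y, z, hk, hx, hy, hz, hd⟩ :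
      ∃ x y z, k ≤ x + y + z ∧ x ≤ α ∧ x + y ≤ β ∧ y + z ≤ γ ∧ z ≤ δ :=
    ⟨min α β, min (β - min α β) (γ - min γ δ), min γ δ, by omega, by omega, by omega, by omega,
      by omega⟩
  exact ⟨min x k, min y (k - min x k), k - min x k - min y (k - min x k), by omega, by omega,
    by omega, by omega, by omega⟩

variable {σ : Type*}

/-- The exponents of the edges of the path `a - b - c - d`, followed by further exponents `t`. -/
noncomputable def pathExponents (a b c d : σ) (t : Fin 3 → σ →₀ ℕ) : Fin 3 ⊕ Fin 3 → σ →₀ ℕ :=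
  Sum.elim ![Finsupp.single a 1 + Finsupp.single b 1, Finsupp.single b 1 + Finsupp.single c 1,
    Finsupp.single c 1 + Finsupp.single d 1] t

theorem path_fits_iff {a b c d : σ} (hab : a ≠ b) (hac : a ≠ c) (had : a ≠ d) (hbc : b ≠ c)
    (hbd : b ≠ d) (hcd : c ≠ d) {t : Fin 3 → σ →₀ ℕ} (hta : ∀ j, t j a = 0) (htb : ∀ j, t j b = 0)
    (htc : ∀ j, t j c = 0) (htd : ∀ j, t j d = 0) (k : ℕ) (m : σ →₀ ℕ) :
    (∃ n : Fin 3 ⊕ Fin 3 → ℕ, ∑ i, n i = k ∧ ∑ i, n i • pathExponents a b c d t i ≤ m) ↔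
      (∃ l, ∃ u : Fin 3 → ℕ, l + ∑ j, u j = k ∧ (l ≤ m b + m c ∧ l ≤ m b + m d) ∧
        ∑ j, u j • t j ≤ m) ∧
      ∃ l, ∃ u : Fin 3 → ℕ, l + ∑ j, u j = k ∧ l ≤ m a + m c ∧ ∑ j, u j • t j ≤ m := by
  classical
  constructor
  · rintro ⟨n, hn, hle⟩
    simp only [Fintype.sum_sum_type, pathExponents, Sum.elim_inl, Sum.elim_inr] at hn hle
    have ha := hle a
    have hb := hle b
    have hc := hle c
    have hd := hle d
    simp [Fin.sum_univ_three, hab, hac, had, hbc, hbd, hcd, hab.symm,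
      hac.symm, had.symm, hbc.symm, hbd.symm, hcd.symm, hta, htb, htc, htd] at ha hb hc hd
    rw [Fin.sum_univ_three (fun i => n (Sum.inl i))] at hn
    have hu := le_trans le_add_self hle
    exact ⟨⟨_, _, hn, by omega, hu⟩, ⟨_, _, hn, by omega, hu⟩⟩
  · rintro ⟨⟨l, u, hl, h₁, hu⟩, ⟨l', u', hl', h₂, hu'⟩⟩
    obtain ⟨l, u, hl, h₁, h₂, h₃, hu⟩ : ∃ l, ∃ u : Fin 3 → ℕ, l + ∑ j, u j = k ∧ l ≤ m b + m c ∧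
        l ≤ m b + m d ∧ l ≤ m a + m c ∧ ∑ j, u j • t j ≤ m := by
      rcases le_total l l' with h | h
      · exact ⟨l, u, hl, h₁.1, h₁.2, h.trans h₂, hu⟩
      · exact ⟨l', u', hl', h.trans h₁.1, h.trans h₁.2, h₂, hu'⟩
    obtain ⟨x, y, z, hk, hx, hy, hz, hd⟩ := exists_path_multiplicities h₁ h₂ h₃
    refine ⟨Sum.elim ![x, y, z] u, ?_, fun i => ?_⟩
    · simpa [Fin.sum_univ_three, hk] using hl
    · have hui := hu i
      simp only [Fintype.sum_sum_type, pathExponents, Sum.elim_inl, Sum.elim_inr]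
      by_cases hia : i = a
      · subst hia
        simpa [Fin.sum_univ_three, Finsupp.single_apply, hab.symm, hac.symm, had.symm, hta] using hx
      by_cases hib : i = b
      · subst hib
        simpa [Fin.sum_univ_three, Finsupp.single_apply, hab, hbc.symm, hbd.symm, htb] using hy
      by_cases hic : i = c
      · subst hic
        simpa [Fin.sum_univ_three, Finsupp.single_apply, hac, hbc, hcd.symm, htc] using hz
      by_cases hid : i = d
      · subst hid
        simpa [Fin.sum_univ_three, Finsupp.single_apply, had, hbd, hcd, htd] using hd
      simpa [Fin.sum_univ_three, Finsupp.single_apply, Ne.symm hia, Ne.symm hib, Ne.symm hic,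
        Ne.symm hid] using hui

theorem sum_smul_le_of_le_add_single {ι : Type*} [Fintype ι] {a : σ} {t : ι → σ →₀ ℕ}
    (hta : ∀ j, t j a = 0) {u : ι → ℕ} {m : σ →₀ ℕ}
    (h : ∑ j, u j • t j ≤ m + Finsupp.single a 1) : ∑ j, u j • t j ≤ m := by
  classical
  intro i
  have hi := h i
  rcases eq_or_ne i a with rfl | hia
  · simp [Finsupp.finsetSum_apply, hta]
  · simpa [Finsupp.single_apply, hia.symm] using hi

/-- `X a + X b` is a nonzerodivisor modulo the powers of a monomial ideal generated by the edges of
the path `a - b - c - d` and by monomials in the other variables. -/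
theorem mem_pow_of_add_mul_mem {R : Type*} [CommRing R] {a b c d : σ} (hab : a ≠ b) (hac : a ≠ c)
    (had : a ≠ d) (hbc : b ≠ c) (hbd : b ≠ d) (hcd : c ≠ d) {t : Fin 3 → σ →₀ ℕ}
    (hta : ∀ j, t j a = 0) (htb : ∀ j, t j b = 0) (htc : ∀ j, t j c = 0) (htd : ∀ j, t j d = 0)
    (k : ℕ) {p : MvPolynomial σ R}
    (hp : (X a + X b) * p ∈
      Ideal.span (Set.range fun i => monomial (pathExponents a b c d t i) (1 : R)) ^ k) :
    p ∈ Ideal.span (Set.range fun i => monomial (pathExponents a b c d t i) (1 : R)) ^ k := by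
  classical
  simp only [span_monomial_pow, mem_ideal_span_monomial_image, Set.mem_ofPred_eq,
    exists_exists_and_eq_and] at hp ⊢
  simp only [path_fits_iff hab hac had hbc hbd hcd hta htb htc htd] at hp ⊢
  intro m hm
  refine ⟨support_of_support_add_mul (a := a) (b := b) hab ?_ ?_ (fun m hm => (hp m hm).1) m hm,
    support_of_support_add_mul (a := b) (b := a) hab.symm ?_ ?_
      (fun m hm => (hp m (by rwa [add_comm])).2) m hm⟩
  · rintro m ⟨l, u, hl, h, hu⟩
    refine ⟨l, u, hl, ?_, hu.trans le_self_add⟩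
    simp only [Finsupp.add_apply]
    omega
  · rintro m ⟨l, u, hl, h, hu⟩
    refine ⟨l, u, hl, ?_, sum_smul_le_of_le_add_single hta hu⟩
    simpa [Finsupp.single_apply, hab, hac, had] using h
  · rintro m ⟨l, u, hl, h, hu⟩
    refine ⟨l, u, hl, ?_, hu.trans le_self_add⟩
    simp only [Finsupp.add_apply]
    omega
  · rintro m ⟨l, u, hl, h, hu⟩
    refine ⟨l, u, hl, ?_, sum_smul_le_of_le_add_single htb hu⟩
    simpa [Finsupp.single_apply, hab.symm, hbc, hbd] using h

end Path

section QuotientDepth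
open scoped Pointwise

theorem idealDepth_quotient_eq_two {R : Type u} [CommRing R] [IsNoetherianRing R] {m I : Ideal R}
    {f g w : R} (hfm : f ∈ m) (hgm : g ∈ m) (hf : ∀ q, f * q ∈ I → q ∈ I)
    (hg : ∀ q, g * q ∈ I ⊔ Ideal.span {f} → q ∈ I ⊔ Ideal.span {f})
    (hw : w ∉ I ⊔ Ideal.span {f} ⊔ Ideal.span {g})
    (hmw : ∀ r ∈ m, r * w ∈ I ⊔ Ideal.span {f} ⊔ Ideal.span {g}) :
    idealDepth m (R ⧸ I) = 2 := by
  let π₀ : R →ₗ[R] R ⧸ I := Submodule.mkQ I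
  let π₁ : R →ₗ[R] QuotSMulTop f (R ⧸ I) := (f • (⊤ : Submodule R (R ⧸ I))).mkQ ∘ₗ π₀
  let π₂ : R →ₗ[R] QuotSMulTop g (QuotSMulTop f (R ⧸ I)) :=
    (g • (⊤ : Submodule R (QuotSMulTop f (R ⧸ I)))).mkQ ∘ₗ π₁
  have hπ₀ : Function.Surjective π₀ := Submodule.mkQ_surjective _
  have hπ₁ : Function.Surjective π₁ := (Submodule.mkQ_surjective _).comp hπ₀
  have hker₀ : LinearMap.ker π₀ = I := Submodule.ker_mkQ _
  have hker₁ : LinearMap.ker π₁ = I ⊔ Ideal.span {f} := by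
    rw [ker_mkQ_smul_top_comp hπ₀, hker₀]
  have hker₂ : LinearMap.ker π₂ = I ⊔ Ideal.span {f} ⊔ Ideal.span {g} := by
    rw [ker_mkQ_smul_top_comp hπ₁, hker₁]
  have hfreg : IsSMulRegular (R ⧸ I) f := isSMulRegular_of_surjective hπ₀ (by rwa [hker₀])
  have hgreg : IsSMulRegular (QuotSMulTop f (R ⧸ I)) g :=
    isSMulRegular_of_surjective hπ₁ (by rwa [hker₁])
  have hsocle : π₂ w ≠ 0 := fun h => hw (hker₂ ▸ LinearMap.mem_ker.mpr h)
  have hmsocle : ∀ r ∈ m, r • π₂ w = 0 := fun r hr => by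
    rw [← map_smul, ← LinearMap.mem_ker, hker₂]
    exact hmw r hr
  have hlt : m • (⊤ : Submodule R (R ⧸ I)) < ⊤ := by
    refine lt_top_iff_ne_top.mpr fun htop => hw ?_
    have hmap : Submodule.map π₀ m = m • ⊤ := by
      rw [← LinearMap.range_eq_top.mpr hπ₀, LinearMap.range_eq_map, ← Submodule.map_smul'']
      simp
    have hone : (1 : R) ∈ Submodule.comap π₀ (Submodule.map π₀ m) := by simp [hmap, htop]
    rw [Submodule.comap_map_eq, hker₀] at hone
    obtain ⟨r, hr, i, hi, hri⟩ := Submodule.mem_sup.mp hone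
    rw [← one_mul w, ← hri, add_mul]
    exact add_mem (hmw r hr)
      (Ideal.mem_sup_left (Ideal.mem_sup_left (Ideal.mul_mem_right _ _ hi)))
  have hfgm : ∀ r ∈ [f, g], r ∈ m := by simp [hfm, hgm]
  have hle : Ideal.ofList [f, g] ≤ m := Ideal.span_le.mpr hfgm
  have hreg : RingTheory.Sequence.IsRegular (R ⧸ I) [f, g] := by
    refine ⟨.cons hfreg (.cons hgreg (.nil _ _)), fun h => hlt.ne ?_⟩
    exact eq_top_iff.mpr (h.le.trans (Submodule.smul_mono_left hle))
  refine IsGreatest.csSup_eq ⟨⟨[f, g], rfl, hfgm, hreg⟩, ?_⟩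
  rintro _ ⟨rs, rfl, hrs, hrs'⟩
  exact length_le_two_of_socle m (R ⧸ I) hlt hfreg hgreg hsocle hmsocle hrs hrs'

end QuotientDepth

section TwoEdges

theorem whiskerEdgeIdeal_twoEdgesGraph (K : Type*) [Field K] :
    whiskerEdgeIdeal K twoEdgesGraph = Ideal.span
      {X (.inr 0) * X (.inl 0), X (.inl 0) * X (.inl 1), X (.inl 1) * X (.inr 1),
        X (.inr 2) * X (.inl 2), X (.inl 2) * X (.inl 3), X (.inl 3) * X (.inr 3)} := by
  apply le_antisymm <;> refine Ideal.span_le.mpr ?_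
  · rintro _ (⟨i, j, hij, rfl⟩ | ⟨i, rfl⟩)
    · rw [twoEdgesGraph, SimpleGraph.fromRel_adj] at hij
      obtain ⟨-, (⟨rfl, rfl⟩ | ⟨rfl, rfl⟩) | (⟨rfl, rfl⟩ | ⟨rfl, rfl⟩)⟩ := hij
      · exact Ideal.subset_span (by simp)
      · exact Ideal.subset_span (by simp)
      · exact Ideal.subset_span (.inr (.inl (mul_comm _ _)))
      · exact Ideal.subset_span (.inr (.inr (.inr (.inr (.inl (mul_comm _ _))))))
    · fin_cases i
      · exact Ideal.subset_span (by simp [mul_comm])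
      · exact Ideal.subset_span (by simp)
      · exact Ideal.subset_span (by simp [mul_comm])
      · exact Ideal.subset_span (by simp)
  · have h₀ : twoEdgesGraph.Adj 0 1 := by simp [twoEdgesGraph]
    have h₂ : twoEdgesGraph.Adj 2 3 := by simp [twoEdgesGraph]
    rintro _ (rfl | rfl | rfl | rfl | rfl | rfl)
    · rw [mul_comm]; exact Ideal.subset_span (Or.inr ⟨0, rfl⟩)
    · exact Ideal.subset_span (Or.inl ⟨0, 1, h₀, rfl⟩)
    · exact Ideal.subset_span (Or.inr ⟨1, rfl⟩)
    · rw [mul_comm]; exact Ideal.subset_span (Or.inr ⟨2, rfl⟩)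
    · exact Ideal.subset_span (Or.inl ⟨2, 3, h₂, rfl⟩)
    · exact Ideal.subset_span (Or.inr ⟨3, rfl⟩)

theorem span_pathExponents {σ R : Type*} [CommRing R] (a b c d : σ) (t : Fin 3 → σ →₀ ℕ) :
    Ideal.span (Set.range fun i => monomial (pathExponents a b c d t i) (1 : R)) =
      Ideal.span {X a * X b, X b * X c, X c * X d, monomial (t 0) 1, monomial (t 1) 1,
        monomial (t 2) 1} := by
  congr 1
  ext p
  simp [pathExponents, Fin.exists_fin_succ, X, monomial_mul, eq_comm (b := p), or_assoc]

variable {K : Type*} [Field K]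

theorem mem_of_first_add_mul_mem {q : MvPolynomial (Fin 4 ⊕ Fin 4) K}
    (hq : (X (.inr 0) + X (.inl 0)) * q ∈ whiskerEdgeIdeal K twoEdgesGraph ^ 4) :
    q ∈ whiskerEdgeIdeal K twoEdgesGraph ^ 4 := by
  let t : Fin 3 → (Fin 4 ⊕ Fin 4) →₀ ℕ :=
    ![Finsupp.single (.inr 2) 1 + Finsupp.single (.inl 2) 1,
      Finsupp.single (.inl 2) 1 + Finsupp.single (.inl 3) 1,
      Finsupp.single (.inl 3) 1 + Finsupp.single (.inr 3) 1]
  have hI : whiskerEdgeIdeal K twoEdgesGraph = Ideal.span (Set.range fun i =>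
      monomial (pathExponents (.inr 0) (.inl 0) (.inl 1) (.inr 1) t i) (1 : K)) := by
    rw [whiskerEdgeIdeal_twoEdgesGraph, span_pathExponents]
    simp [t, X, monomial_mul]
  rw [hI] at hq ⊢
  refine mem_pow_of_add_mul_mem ?_ ?_ ?_ ?_ ?_ ?_ ?_ ?_ ?_ ?_ 4 hq <;>
    simp [t, Fin.forall_fin_succ]

/-- The edge ideal after substituting `x₁ = -y₁`. -/
noncomputable def foldedIdeal (K : Type*) [Field K] : Ideal (MvPolynomial (Fin 4 ⊕ Fin 4) K) :=
  Ideal.span {X (.inr 2) * X (.inl 2), X (.inl 2) * X (.inl 3), X (.inl 3) * X (.inr 3),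
    X (.inr 0) * X (.inr 0), X (.inr 0) * X (.inl 1), X (.inl 1) * X (.inr 1)}

theorem mem_foldedIdeal_of_add_mul_mem {q : MvPolynomial (Fin 4 ⊕ Fin 4) K}
    (hq : (X (.inr 2) + X (.inl 2)) * q ∈ foldedIdeal K ^ 4) : q ∈ foldedIdeal K ^ 4 := by
  let t : Fin 3 → (Fin 4 ⊕ Fin 4) →₀ ℕ :=
    ![Finsupp.single (.inr 0) 1 + Finsupp.single (.inr 0) 1,
      Finsupp.single (.inr 0) 1 + Finsupp.single (.inl 1) 1,
      Finsupp.single (.inl 1) 1 + Finsupp.single (.inr 1) 1]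
  have hI : foldedIdeal K = Ideal.span (Set.range fun i =>
      monomial (pathExponents (.inr 2) (.inl 2) (.inl 3) (.inr 3) t i) (1 : K)) := by
    rw [foldedIdeal, span_pathExponents]
    simp [t, X, monomial_mul]
  rw [hI] at hq ⊢
  refine mem_pow_of_add_mul_mem ?_ ?_ ?_ ?_ ?_ ?_ ?_ ?_ ?_ ?_ 4 hq <;>
    simp [t, Fin.forall_fin_succ]

/-- The substitution `x₁ ↦ -y₁`. -/
noncomputable def fold (K : Type*) [Field K] :
    MvPolynomial (Fin 4 ⊕ Fin 4) K →ₐ[K] MvPolynomial (Fin 4 ⊕ Fin 4) K :=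
  aeval (Function.update X (.inl 0) (-X (.inr 0)))

theorem sub_fold_mem (p : MvPolynomial (Fin 4 ⊕ Fin 4) K) :
    p - fold K p ∈ Ideal.span {X (.inr 0) + X (.inl 0)} := by
  induction p using MvPolynomial.induction_on with
  | C r => simp [fold]
  | add p q hp hq =>
    rw [map_add, add_sub_add_comm]
    exact add_mem hp hq
  | mul_X p i hp =>
    have hi : X i - fold K (X i) ∈ Ideal.span {X (.inr 0) + X (.inl 0)} := by
      rw [fold, aeval_X, Function.update_apply]
      split_ifs with h
      · rw [h, sub_neg_eq_add, add_comm]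
        exact Ideal.mem_span_singleton_self _
      · simp
    rw [map_mul, show p * X i - fold K p * fold K (X i) =
      X i * (p - fold K p) + fold K p * (X i - fold K (X i)) by ring]
    exact add_mem (Ideal.mul_mem_left _ _ hp) (Ideal.mul_mem_left _ _ hi)

theorem map_fold_le : (whiskerEdgeIdeal K twoEdgesGraph).map (fold K) ≤ foldedIdeal K := by
  rw [whiskerEdgeIdeal_twoEdgesGraph, Ideal.map_span, Ideal.span_le]
  rintro _ ⟨_, (rfl | rfl | rfl | rfl | rfl | rfl), rfl⟩ <;>
    simp only [fold, map_mul, aeval_X, Function.update_apply, reduceCtorEq, if_false, if_true,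
      Sum.inl.injEq, Fin.reduceEq, SetLike.mem_coe, mul_neg, neg_mul, neg_mem_iff] <;>
    exact Ideal.subset_span (by simp)

theorem foldedIdeal_le : foldedIdeal K ≤
    whiskerEdgeIdeal K twoEdgesGraph ⊔ Ideal.span {X (.inr 0) + X (.inl 0)} := by
  rw [whiskerEdgeIdeal_twoEdgesGraph, foldedIdeal, Ideal.span_le]
  have hf (p : MvPolynomial (Fin 4 ⊕ Fin 4) K) :
      p * (X (.inr 0) + X (.inl 0)) ∈ Ideal.span {X (.inr 0) + X (.inl 0)} :=
    Ideal.mul_mem_left _ _ (Ideal.mem_span_singleton_self _)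
  rintro _ (rfl | rfl | rfl | rfl | rfl | rfl)
  · exact Ideal.mem_sup_left (Ideal.subset_span (by simp))
  · exact Ideal.mem_sup_left (Ideal.subset_span (by simp))
  · exact Ideal.mem_sup_left (Ideal.subset_span (by simp))
  · rw [show (X (.inr 0) * X (.inr 0) : MvPolynomial (Fin 4 ⊕ Fin 4) K) =
      X (.inr 0) * (X (.inr 0) + X (.inl 0)) - X (.inr 0) * X (.inl 0) by ring]
    exact sub_mem (Ideal.mem_sup_right (hf _)) (Ideal.mem_sup_left (Ideal.subset_span (by simp)))
  · rw [show (X (.inr 0) * X (.inl 1) : MvPolynomial (Fin 4 ⊕ Fin 4) K) =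
      X (.inl 1) * (X (.inr 0) + X (.inl 0)) - X (.inl 0) * X (.inl 1) by ring]
    exact sub_mem (Ideal.mem_sup_right (hf _)) (Ideal.mem_sup_left (Ideal.subset_span (by simp)))
  · exact Ideal.mem_sup_left (Ideal.subset_span (by simp))

theorem mem_of_second_add_mul_mem {q : MvPolynomial (Fin 4 ⊕ Fin 4) K}
    (hq : (X (.inr 2) + X (.inl 2)) * q ∈
      whiskerEdgeIdeal K twoEdgesGraph ^ 4 ⊔ Ideal.span {X (.inr 0) + X (.inl 0)}) :
    q ∈ whiskerEdgeIdeal K twoEdgesGraph ^ 4 ⊔ Ideal.span {X (.inr 0) + X (.inl 0)} := by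
  have hle : (whiskerEdgeIdeal K twoEdgesGraph ^ 4 ⊔
      Ideal.span {X (.inr 0) + X (.inl 0)}).map (fold K) ≤ foldedIdeal K ^ 4 := by
    rw [Ideal.map_sup, Ideal.map_pow]
    refine sup_le (Ideal.pow_right_mono map_fold_le 4) ?_
    simp [Ideal.map_span, fold]
  have hfold := hle (Ideal.mem_map_of_mem (fold K) hq)
  rw [map_mul, show fold K (X (.inr 2) + X (.inl 2)) = X (.inr 2) + X (.inl 2) by simp [fold]]
    at hfold
  have hmem := (Ideal.pow_right_mono foldedIdeal_le 4).trans (sup_pow_le _ _ 4)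
    (mem_foldedIdeal_of_add_mul_mem hfold)
  simpa using add_mem (Ideal.mem_sup_right (sub_fold_mem q)) hmem

/-- A socle element of the quotient of `S* / I(G*)^4` by `y₁ + x₁` and `y₃ + x₃`. -/
noncomputable def socleRep (K : Type*) [Field K] : MvPolynomial (Fin 4 ⊕ Fin 4) K :=
  X (.inr 0) ^ 2 * X (.inl 0) ^ 2 * X (.inl 1) * (X (.inr 2) * X (.inl 2) * X (.inl 3))

variable (K) in
/-- The ideal `I(G*)^4 + (y₁ + x₁, y₃ + x₃)`. -/
noncomputable def reducedIdeal : Ideal (MvPolynomial (Fin 4 ⊕ Fin 4) K) :=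
  whiskerEdgeIdeal K twoEdgesGraph ^ 4 ⊔ Ideal.span {X (.inr 0) + X (.inl 0)} ⊔
    Ideal.span {X (.inr 2) + X (.inl 2)}

theorem mul_socleRep_mem {r : MvPolynomial (Fin 4 ⊕ Fin 4) K}
    (hr : r ∈ maxIdeal (Fin 4 ⊕ Fin 4) K) : r * socleRep K ∈ reducedIdeal K := by
  suffices h : maxIdeal (Fin 4 ⊕ Fin 4) K ≤ (reducedIdeal K).colon {socleRep K} by
    simpa using Submodule.mem_colon_singleton.mp (h hr)
  have key {e₁ e₂ e₃ e₄ : MvPolynomial (Fin 4 ⊕ Fin 4) K}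
      (h₁ : e₁ ∈ whiskerEdgeIdeal K twoEdgesGraph) (h₂ : e₂ ∈ whiskerEdgeIdeal K twoEdgesGraph)
      (h₃ : e₃ ∈ whiskerEdgeIdeal K twoEdgesGraph) (h₄ : e₄ ∈ whiskerEdgeIdeal K twoEdgesGraph)
      (s u v : MvPolynomial (Fin 4 ⊕ Fin 4) K) :
      s * (e₁ * e₂ * e₃ * e₄) + u * (X (.inr 0) + X (.inl 0)) + v * (X (.inr 2) + X (.inl 2)) ∈
        reducedIdeal K := by
    refine add_mem (Ideal.mem_sup_left (add_mem (Ideal.mem_sup_left (Ideal.mul_mem_left _ _ ?_))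
      (Ideal.mem_sup_right (Ideal.mul_mem_left _ _ (Ideal.mem_span_singleton_self _)))))
      (Ideal.mem_sup_right (Ideal.mul_mem_left _ _ (Ideal.mem_span_singleton_self _)))
    rw [pow_succ, pow_succ, pow_two]
    exact Ideal.mul_mem_mul (Ideal.mul_mem_mul (Ideal.mul_mem_mul h₁ h₂) h₃) h₄
  have hmem {e : MvPolynomial (Fin 4 ⊕ Fin 4) K} (he : e ∈ ({X (.inr 0) * X (.inl 0),
      X (.inl 0) * X (.inl 1), X (.inl 1) * X (.inr 1), X (.inr 2) * X (.inl 2),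
      X (.inl 2) * X (.inl 3), X (.inl 3) * X (.inr 3)} : Set (MvPolynomial (Fin 4 ⊕ Fin 4) K))) :
      e ∈ whiskerEdgeIdeal K twoEdgesGraph := by
    rw [whiskerEdgeIdeal_twoEdgesGraph]
    exact Ideal.subset_span he
  have hab := hmem (e := X (.inr 0) * X (.inl 0)) (by simp)
  have hbc := hmem (e := X (.inl 0) * X (.inl 1)) (by simp)
  have hcd := hmem (e := X (.inl 1) * X (.inr 1)) (by simp)
  have hab' := hmem (e := X (.inr 2) * X (.inl 2)) (by simp)
  have hbc' := hmem (e := X (.inl 2) * X (.inl 3)) (by simp)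
  have hcd' := hmem (e := X (.inl 3) * X (.inr 3)) (by simp)
  rw [maxIdeal, Ideal.span_le]
  rintro _ ⟨i, rfl⟩
  rw [SetLike.mem_coe, Submodule.mem_colon_singleton, smul_eq_mul, socleRep]
  generalize (X : Fin 4 ⊕ Fin 4 → MvPolynomial (Fin 4 ⊕ Fin 4) K) = Y at *
  rcases i with i | i <;> fin_cases i <;> dsimp only [Fin.mk_one, Fin.zero_eta, Fin.reduceFinMk]
  · convert key hab hab hbc hab' (Y (.inl 3)) 0 0 using 1
    ring
  · convert key hab hbc hbc hab' (-Y (.inl 3)) (Y (.inr 0) * Y (.inl 0) ^ 2 * Y (.inl 1) ^ 2 *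
      (Y (.inr 2) * Y (.inl 2) * Y (.inl 3))) 0 using 1
    ring
  · convert key hab hab hab' hbc' (Y (.inl 1)) 0 0 using 1
    ring
  · convert key hab hab hbc' hbc' (-Y (.inl 1)) 0 (Y (.inr 0) ^ 2 * Y (.inl 0) ^ 2 * Y (.inl 1) *
      (Y (.inl 2) * Y (.inl 3) ^ 2)) using 1
    ring
  · convert key hab hab hbc hab' (-Y (.inl 3)) (Y (.inr 0) ^ 2 * Y (.inl 0) ^ 2 * Y (.inl 1) *
      (Y (.inr 2) * Y (.inl 2) * Y (.inl 3))) 0 using 1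
    ring
  · convert key hab hab hcd hab' (Y (.inl 3)) 0 0 using 1
    ring
  · convert key hab hab hab' hbc' (-Y (.inl 1)) 0 (Y (.inr 0) ^ 2 * Y (.inl 0) ^ 2 * Y (.inl 1) *
      (Y (.inr 2) * Y (.inl 2) * Y (.inl 3))) using 1
    ring
  · convert key hab hab hab' hcd' (Y (.inl 1)) 0 0 using 1
    ring

theorem socleRep_notMem : socleRep K ∉ reducedIdeal K := by
  intro h
  let ψ : MvPolynomial (Fin 4 ⊕ Fin 4) K →ₐ[K] MvPolynomial (Fin 2) K :=
    aeval (Sum.elim ![-X 0, X 0, -X 1, X 1] ![X 0, X 0, X 1, X 1])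
  let e : Fin 2 → Fin 2 →₀ ℕ := fun i => Finsupp.single i 1 + Finsupp.single i 1
  let L : Ideal (MvPolynomial (Fin 2) K) := Ideal.span (Set.range fun i => monomial (e i) 1)
  have hL (i : Fin 2) : (X i * X i : MvPolynomial (Fin 2) K) ∈ L :=
    Ideal.subset_span ⟨i, by simp [e, X, monomial_mul]⟩
  have hI : (whiskerEdgeIdeal K twoEdgesGraph).map ψ ≤ L := by
    rw [whiskerEdgeIdeal_twoEdgesGraph, Ideal.map_span, Ideal.span_le]
    rintro _ ⟨_, (rfl | rfl | rfl | rfl | rfl | rfl), rfl⟩ <;> simp [ψ, hL]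
  have hle : (reducedIdeal K).map ψ ≤ L ^ 4 := by
    rw [reducedIdeal, Ideal.map_sup, Ideal.map_sup, Ideal.map_pow]
    refine sup_le (sup_le (Ideal.pow_right_mono hI 4) ?_) ?_ <;> simp [Ideal.map_span, ψ]
  have hmem := hle (Ideal.mem_map_of_mem ψ h)
  have hψ : ψ (socleRep K) = -monomial (Finsupp.single 0 5 + Finsupp.single 1 3) 1 := by
    rw [← one_mul (1 : K), ← monomial_mul, ← X_pow_eq_monomial, ← X_pow_eq_monomial]
    simp [ψ, socleRep]
    ring
  rw [hψ, neg_mem_iff, span_monomial_pow, mem_ideal_span_monomial_image] at hmem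
  obtain ⟨_, ⟨c, hc, rfl⟩, hle⟩ := hmem (Finsupp.single 0 5 + Finsupp.single 1 3) (by simp)
  have h₀ := hle 0
  have h₁ := hle 1
  simp [e] at hc h₀ h₁
  omega

end TwoEdges

/-- For the disconnected graph `G` with edges `{1,2}` and `{3,4}` on `n = 4` vertices one has
`depth(S*/I(G*)^4) = 2`; in particular the bound `depth(S*/I(G*)^k) ≤ n - k + 1` of the
connected case fails (here `n - 4 + 1 = 1 < 2`). -/
theorem depth_whisker_two_edges_fourth_power (K : Type*) [Field K] :
    idealDepth (maxIdeal (Fin 4 ⊕ Fin 4) K)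
      (MvPolynomial (Fin 4 ⊕ Fin 4) K ⧸ (whiskerEdgeIdeal K twoEdgesGraph) ^ 4) = 2 ∧
    (4 - 4 + 1 : ℕ) < 2 := by
  have hX (i : Fin 4 ⊕ Fin 4) : X i ∈ maxIdeal (Fin 4 ⊕ Fin 4) K := Ideal.subset_span ⟨i, rfl⟩
  exact ⟨idealDepth_quotient_eq_two (add_mem (hX _) (hX _)) (add_mem (hX _) (hX _))
    (fun _ => mem_of_first_add_mul_mem) (fun _ => mem_of_second_add_mul_mem) socleRep_notMem
    (fun _ => mul_socleRep_mem), by norm_num⟩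
end
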